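/- For all integers ℓ ≥ 2, k > 1 and l > 1 there exists a (k,l)-grid-free simple graph G with exactly n = 4(k+l)ℓ − 2(k+l) + 1 vertices such that cr_{(k,l)-grid-free}(G) ≥ ℓ and cr(G) ≤ kl (hence the (k,l)-grid-free crossing ratio is Ω(n/(kl(k+l)))). -/

import Mathlib

open Set

noncomputable section

/-- A drawing of a simple graph in the plane: vertices are mapped to distinct
points, each edge `uv` is drawn as a simple arc joining the images of `u` and
`v` and avoiding the images of the other vertices, any two arcs meet in
finitely many points, and no three arcs pass through a common non-vertex
point. -/
structure Drawing {V : Type} (G : SimpleGraph V) where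
  vpos : V → ℝ × ℝ
  vpos_inj : Function.Injective vpos
  arc : V → V → ℝ → ℝ × ℝ
  arc_symm : ∀ u v t, arc u v t = arc v u (1 - t)
  arc_cont : ∀ u v, G.Adj u v → ContinuousOn (arc u v) (Set.Icc 0 1)
  arc_injOn : ∀ u v, G.Adj u v → Set.InjOn (arc u v) (Set.Icc 0 1)
  arc_start : ∀ u v, G.Adj u v → arc u v 0 = vpos u
  arc_end : ∀ u v, G.Adj u v → arc u v 1 = vpos v
  arc_avoids : ∀ u v, G.Adj u v → ∀ t ∈ Set.Ioo (0:ℝ) 1, arc u v t ∉ Set.range vpos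
  inter_finite : ∀ u v w z, G.Adj u v → G.Adj w z → s(u, v) ≠ s(w, z) →
    ((arc u v '' Set.Icc 0 1) ∩ (arc w z '' Set.Icc 0 1)).Finite
  no_triple_point : ∀ p : ℝ × ℝ, p ∉ Set.range vpos →
    ∀ u₁ v₁ u₂ v₂ u₃ v₃, G.Adj u₁ v₁ → G.Adj u₂ v₂ → G.Adj u₃ v₃ →
      s(u₁, v₁) ≠ s(u₂, v₂) → s(u₁, v₁) ≠ s(u₃, v₃) → s(u₂, v₂) ≠ s(u₃, v₃) →
      ¬ (p ∈ arc u₁ v₁ '' Set.Icc 0 1 ∧ p ∈ arc u₂ v₂ '' Set.Icc 0 1 ∧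
          p ∈ arc u₃ v₃ '' Set.Icc 0 1)

namespace Drawing

variable {V : Type} {G : SimpleGraph V}

lemma img_symm_aux (Γ : Drawing G) (u v : V) :
    Γ.arc u v '' Set.Icc 0 1 = Γ.arc v u '' Set.Icc 0 1 := by
  have key : ∀ a b : V, Γ.arc a b '' Set.Icc 0 1 ⊆ Γ.arc b a '' Set.Icc 0 1 := by
    rintro a b p ⟨t, ht, rfl⟩
    refine ⟨1 - t, ⟨by linarith [ht.2], by linarith [ht.1]⟩, ?_⟩
    rw [Γ.arc_symm b a (1 - t)]
    congr 1
    ring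
  exact Set.Subset.antisymm (key u v) (key v u)

/-- The image (trace) of an edge in the drawing. -/
def img (Γ : Drawing G) (e : Sym2 V) : Set (ℝ × ℝ) :=
  Sym2.lift ⟨fun u v => Γ.arc u v '' Set.Icc 0 1, fun u v => Γ.img_symm_aux u v⟩ e

/-- `p` is a crossing point of the two distinct edges `e` and `f` : it lies on
both arcs and is not the image of a vertex (so it is not a shared endpoint). -/
def Crossing (Γ : Drawing G) (e f : Sym2 V) (p : ℝ × ℝ) : Prop :=
  e ∈ G.edgeSet ∧ f ∈ G.edgeSet ∧ e ≠ f ∧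
    p ∈ Γ.img e ∧ p ∈ Γ.img f ∧ p ∉ Set.range Γ.vpos

/-- The edges `e` and `f` cross in the drawing. -/
def Crosses (Γ : Drawing G) (e f : Sym2 V) : Prop := ∃ p, Γ.Crossing e f p

/-- The set of crossing points of a drawing. -/
def crossingSet (Γ : Drawing G) : Set (ℝ × ℝ) := {p | ∃ e f, Γ.Crossing e f p}

/-- The number of crossings of a drawing. -/
def crossings (Γ : Drawing G) : ℕ := Γ.crossingSet.ncard

/-- The set of crossing points lying on a given edge. -/
def edgeCrossings (Γ : Drawing G) (e : Sym2 V) : Set (ℝ × ℝ) :=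
  {p | ∃ f, Γ.Crossing e f p}

/-- A drawing is `k`-planar if every edge is involved in at most `k` crossings. -/
def IsKPlanar (Γ : Drawing G) (k : ℕ) : Prop :=
  ∀ e ∈ G.edgeSet, (Γ.edgeCrossings e).ncard ≤ k

/-- A drawing is `k`-gap-planar if each crossing can be assigned to one of its
two involved edges such that every edge is assigned at most `k` crossings. -/
def IsKGapPlanar (Γ : Drawing G) (k : ℕ) : Prop :=
  ∃ assign : ℝ × ℝ → Sym2 V,
    (∀ p ∈ Γ.crossingSet, ∃ f, Γ.Crossing (assign p) f p) ∧
    ∀ e : Sym2 V, {p | p ∈ Γ.crossingSet ∧ assign p = e}.ncard ≤ k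

/-- A drawing is skewness-`k` if there is a set of at most `k` edges such that
every crossing involves an edge from the set. -/
def IsSkewness (Γ : Drawing G) (k : ℕ) : Prop :=
  ∃ S : Finset (Sym2 V), S.card ≤ k ∧
    ∀ p ∈ Γ.crossingSet, ∃ e ∈ S, ∃ f, Γ.Crossing e f p

/-- A drawing is `k`-apex if there is a set of at most `k` vertices such that
every crossing involves an edge incident to one of these vertices. -/
def IsKApex (Γ : Drawing G) (k : ℕ) : Prop :=
  ∃ S : Finset V, S.card ≤ k ∧
    ∀ p ∈ Γ.crossingSet, ∃ e f, Γ.Crossing e f p ∧ ∃ a ∈ S, a ∈ e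

/-- A drawing is `(k,l)`-grid-free if there is no set of `k` edges each of
which crosses each edge of some set of `l` edges. -/
def IsGridFree (Γ : Drawing G) (k l : ℕ) : Prop :=
  ¬ ∃ A B : Finset (Sym2 V), A.card = k ∧ B.card = l ∧
      ∀ e ∈ A, ∀ f ∈ B, Γ.Crosses e f

/-- A drawing is `k`-fan-crossing-free if no edge crosses `k` edges that all
share a common endpoint. -/
def IsKFanCrossingFree (Γ : Drawing G) (k : ℕ) : Prop :=
  ¬ ∃ (e : Sym2 V) (a : V) (F : Finset (Sym2 V)), F.card = k ∧
      ∀ f ∈ F, a ∈ f ∧ Γ.Crosses e f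

/-- A drawing is planarly connected if for any two crossing edges, two of
their endpoints are joined by a crossing-free edge. -/
def IsPlanarlyConnected (Γ : Drawing G) : Prop :=
  ∀ e f : Sym2 V, Γ.Crosses e f →
    ∃ a b : V, a ∈ e ∧ b ∈ f ∧ G.Adj a b ∧ Γ.edgeCrossings s(a, b) = ∅

/-- A drawing is straight-line if every edge is drawn as the line segment
between the images of its endpoints. -/
def IsStraight (Γ : Drawing G) : Prop :=
  ∀ u v : V, G.Adj u v → ∀ t ∈ Set.Icc (0:ℝ) 1,
    Γ.arc u v t = (1 - t) • Γ.vpos u + t • Γ.vpos v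

/-- A straight-line RAC drawing: straight-line and any two crossing edges are
perpendicular. -/
def IsRAC (Γ : Drawing G) : Prop :=
  Γ.IsStraight ∧
    ∀ u v w z : V, G.Adj u v → G.Adj w z → Γ.Crosses s(u, v) s(w, z) →
      (Γ.vpos v - Γ.vpos u).1 * (Γ.vpos z - Γ.vpos w).1 +
        (Γ.vpos v - Γ.vpos u).2 * (Γ.vpos z - Γ.vpos w).2 = 0

end Drawing

/-- The crossing number of `G`: the minimum number of crossings over all
drawings of `G`. -/
def crNum {V : Type} (G : SimpleGraph V) : ℕ :=
  sInf {n | ∃ Γ : Drawing G, Γ.crossings = n}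

/-- The crossing number of `G` restricted to drawings satisfying `P`. -/
def crNumRestricted {V : Type} (G : SimpleGraph V) (P : Drawing G → Prop) : ℕ :=
  sInf {n | ∃ Γ : Drawing G, P Γ ∧ Γ.crossings = n}

/-- The rectilinear crossing number of `G`. -/
def rectCrNum {V : Type} (G : SimpleGraph V) : ℕ :=
  crNumRestricted G (fun Γ => Γ.IsStraight)

/-- An ℓ₂-bundle between `x` and `y`: `P` is the set of the internal vertices
of ℓ internally disjoint paths of length two from `x` to `y`, all of whose
internal vertices have degree exactly two in `G` (here ℓ = `P.card`). -/
def IsL2Bundle {V : Type} (G : SimpleGraph V) (x y : V) (P : Finset V) : Prop :=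
  x ≠ y ∧ x ∉ P ∧ y ∉ P ∧
    ∀ p ∈ P, G.Adj x p ∧ G.Adj p y ∧ (G.neighborSet p).ncard = 2

/-- Two drawings of `G` are weakly isomorphic: there is an incidence-preserving
one-to-one correspondence of vertices and edges that preserves crossings. -/
def WeaklyIso {V : Type} {G : SimpleGraph V} (Γ Γ' : Drawing G) : Prop :=
  ∃ φ : G ≃g G, ∀ e f : Sym2 V,
    Γ.Crosses e f ↔ Γ'.Crosses (Sym2.map (fun a => φ a) e) (Sym2.map (fun a => φ a) f)

/-- `w` is the total increment along `f` of a continuous branch of the logarithm. -/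
def HasLogIncrement (f : unitInterval → ℂ) (w : ℂ) : Prop :=
  ∃ L : unitInterval → ℂ, Continuous L ∧ (∀ s, Complex.exp (L s) = f s) ∧ w = L 1 - L 0

lemma HasLogIncrement.unique {f : unitInterval → ℂ} {w w' : ℂ} (h : HasLogIncrement f w)
    (h' : HasLogIncrement f w') : w = w' := by
  obtain ⟨L, hL, hLf, rfl⟩ := h
  obtain ⟨M, hM, hMf, rfl⟩ := h'
  have hexp : Complex.exp (L 0 - M 0) = 1 := by
    rw [Complex.exp_sub, hLf, hMf, ← hMf, div_self (Complex.exp_ne_zero _)]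
  have key : L = fun s => M s + (L 0 - M 0) := by
    refine Complex.isCoveringMap_exp.eq_of_comp_eq hL (by fun_prop) ?_ 0 (by ring)
    funext s
    apply Subtype.ext
    simp only [Function.comp_apply]
    rw [Complex.exp_add, hexp, mul_one, hLf, hMf]
  have h1 := congrFun key 1
  rw [h1]; ring

lemma HasLogIncrement.neg {f : unitInterval → ℂ} {w : ℂ} (h : HasLogIncrement f w) :
    HasLogIncrement (fun s => - f s) w := by
  obtain ⟨L, hL, hLf, rfl⟩ := h
  refine ⟨fun s => L s + Real.pi * Complex.I, by fun_prop, fun s => ?_, by ring⟩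
  rw [Complex.exp_add, Complex.exp_pi_mul_I, hLf]; ring

lemma HasLogIncrement.exp_eq {f : unitInterval → ℂ} {w : ℂ} (h : HasLogIncrement f w) :
    Complex.exp w = f 1 / f 0 := by
  obtain ⟨L, hL, hLf, rfl⟩ := h
  rw [Complex.exp_sub, hLf, hLf]

lemma exists_continuous_log_square {g : unitInterval × unitInterval → ℂ} (hg : Continuous g)
    (h0 : ∀ p, g p ≠ 0) :
    ∃ L : unitInterval × unitInterval → ℂ, Continuous L ∧ ∀ p, Complex.exp (L p) = g p := by
  let r : ℝ × ℝ → unitInterval × unitInterval :=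
    Prod.map (projIcc 0 1 zero_le_one) (projIcc 0 1 zero_le_one)
  have hr : Continuous r := continuous_projIcc.prodMap continuous_projIcc
  obtain ⟨F, ⟨-, hF⟩, -⟩ := Complex.isCoveringMap_exp.existsUnique_continuousMap_lifts
    (A := ℝ × ℝ) ⟨fun p => ⟨g (r p), h0 _⟩, by fun_prop⟩ (0, 0)
    (Complex.log (g (r (0, 0)))) (Subtype.ext (Complex.exp_log (h0 _)))
  refine ⟨fun p => F (p.1, p.2), by fun_prop, fun p => ?_⟩
  have h : Complex.exp (F (p.1, p.2)) = g (r (p.1, p.2)) := congrArg Subtype.val (congrFun hF _)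
  rw [h]
  simp [r]

lemma exists_logIncrement_square {g : unitInterval × unitInterval → ℂ} (hg : Continuous g)
    (h0 : ∀ p, g p ≠ 0) :
    ∃ w₁ w₂ w₃ w₄, HasLogIncrement (fun s => g (s, 0)) w₁ ∧ HasLogIncrement (fun t => g (1, t)) w₂ ∧
      HasLogIncrement (fun t => g (0, t)) w₃ ∧ HasLogIncrement (fun s => g (s, 1)) w₄ ∧
      w₁ + w₂ = w₃ + w₄ := by
  obtain ⟨L, hL, hLg⟩ := exists_continuous_log_square hg h0
  exact ⟨_, _, _, _, ⟨fun s => L (s, 0), by fun_prop, fun s => hLg _, rfl⟩,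
    ⟨fun t => L (1, t), by fun_prop, fun s => hLg _, rfl⟩,
    ⟨fun t => L (0, t), by fun_prop, fun s => hLg _, rfl⟩,
    ⟨fun s => L (s, 1), by fun_prop, fun s => hLg _, rfl⟩, by ring⟩

lemma exists_int_of_exp_eq {z w : ℂ} (h : Complex.exp z = Complex.exp w) :
    ∃ n : ℤ, z = w + n * (2 * Real.pi * Complex.I) :=
  Complex.exp_eq_exp_iff_exists_int.1 h

/-- `K₃,₃` is not planar, even when its edges are drawn as arbitrary (possibly non-simple) paths and
only independent edges are required to be disjoint. -/
theorem exists_independent_paths_meet (P Q : Fin 3 → ℂ) (γ : ∀ i j, Path (P i) (Q j)) :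
    ∃ i i' j j', i ≠ i' ∧ j ≠ j' ∧ ∃ s t, γ i j s = γ i' j' t := by
  by_contra! hne
  have oth : ∀ i : Fin 3, ∃ i', i ≠ i' := by decide
  have hPQ : ∀ i j, Q j - P i ≠ 0 := by
    intro i j h
    obtain ⟨i', hi⟩ := oth i
    obtain ⟨j', hj⟩ := oth j
    refine hne i i' j' j hi hj.symm 0 1 ?_
    simp [sub_eq_zero.1 h]
  have hPP : ∀ i i', i ≠ i' → P i - P i' ≠ 0 := by
    intro i i' hi h
    refine hne i i' 0 1 hi (by decide) 0 0 ?_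
    simp [sub_eq_zero.1 h]
  have hQQ : ∀ j j', j ≠ j' → Q j - Q j' ≠ 0 := by
    intro j j' hj h
    refine hne 0 1 j j' (by decide) hj 1 1 ?_
    simp [sub_eq_zero.1 h]
  have sq : ∀ i i' j j', i ≠ i' → j ≠ j' → ∃ w₁ w₂ w₃ w₄,
      HasLogIncrement (fun s => γ i j s - P i') w₁ ∧ HasLogIncrement (fun t => γ i' j' t - Q j) w₂ ∧
      HasLogIncrement (fun t => γ i' j' t - P i) w₃ ∧ HasLogIncrement (fun s => γ i j s - Q j') w₄ ∧
      w₁ + w₂ = w₃ + w₄ := by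
    intro i i' j j' hi hj
    obtain ⟨w₁, w₂, w₃, w₄, h₁, h₂, h₃, h₄, h⟩ := exists_logIncrement_square
      (g := fun p => γ i j p.1 - γ i' j' p.2) (by fun_prop)
      (fun p hp => hne i i' j j' hi hj p.1 p.2 (sub_eq_zero.1 hp))
    exact ⟨w₁, w₂, w₃, w₄, by simpa using h₁, by simpa using h₂.neg, by simpa using h₃.neg,
      by simpa using h₄, h⟩
  have ha : ∀ i' i j, ∃ w, i ≠ i' → HasLogIncrement (fun s => γ i j s - P i') w := by
    intro i' i j
    by_cases hi : i = i'
    · exact ⟨0, fun h => (h hi).elim⟩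
    · obtain ⟨j', hj⟩ := oth j
      obtain ⟨w, _, _, _, h, _⟩ := sq i i' j j' hi hj
      exact ⟨w, fun _ => h⟩
  have hb : ∀ j' i j, ∃ w, j ≠ j' → HasLogIncrement (fun s => γ i j s - Q j') w := by
    intro j' i j
    by_cases hj : j = j'
    · exact ⟨0, fun h => (h hj).elim⟩
    · obtain ⟨i', hi⟩ := oth i
      obtain ⟨_, _, _, w, _, _, _, h, _⟩ := sq i i' j j' hi hj
      exact ⟨w, fun _ => h⟩
  choose a ha using ha
  choose b hb using hb
  have rel : ∀ i i' j j', i ≠ i' → j ≠ j' → a i' i j + b j i' j' = a i i' j' + b j' i j := by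
    intro i i' j j' hi hj
    obtain ⟨w₁, w₂, w₃, w₄, h₁, h₂, h₃, h₄, h⟩ := sq i i' j j' hi hj
    rw [(ha i' i j hi).unique h₁, (hb j i' j' hj.symm).unique h₂, (ha i i' j' hi.symm).unique h₃,
      (hb j' i j hj).unique h₄, h]
  -- choice of logarithms of the differences of vertices
  let lg (R : Fin 3 → ℂ) (i i' : Fin 3) : ℂ :=
    if i < i' then Complex.log (R i - R i') else Complex.log (R i' - R i) + Real.pi * Complex.I
  have hlg : ∀ (R : Fin 3 → ℂ), (∀ i i', i ≠ i' → R i - R i' ≠ 0) →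
      ∀ i i', i ≠ i' → Complex.exp (lg R i i') = R i - R i' := by
    intro R hR i i' hi
    simp only [lg]
    split_ifs with h
    · exact Complex.exp_log (hR _ _ hi)
    · rw [Complex.exp_add, Complex.exp_log (hR _ _ hi.symm), Complex.exp_pi_mul_I]; ring
  have hn : ∀ i' i j, ∃ n : ℤ, i ≠ i' →
      a i' i j = Complex.log (Q j - P i') - lg P i i' + n * (2 * Real.pi * Complex.I) := by
    intro i' i j
    by_cases hi : i = i'
    · exact ⟨0, fun h => (h hi).elim⟩
    · obtain ⟨n, hn⟩ := exists_int_of_exp_eq (z := a i' i j)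
        (w := Complex.log (Q j - P i') - lg P i i') (by
          rw [(ha i' i j hi).exp_eq, Complex.exp_sub, hlg P hPP i i' hi, Complex.exp_log (hPQ _ _)]
          simp)
      exact ⟨n, fun _ => hn⟩
  have hm : ∀ j' i j, ∃ n : ℤ, j ≠ j' →
      b j' i j = lg Q j j' - (Complex.log (Q j' - P i) + Real.pi * Complex.I)
        + n * (2 * Real.pi * Complex.I) := by
    intro j' i j
    by_cases hj : j = j'
    · exact ⟨0, fun h => (h hj).elim⟩
    · obtain ⟨n, hn⟩ := exists_int_of_exp_eq (z := b j' i j)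
        (w := lg Q j j' - (Complex.log (Q j' - P i) + Real.pi * Complex.I)) (by
          rw [(hb j' i j hj).exp_eq, Complex.exp_sub, hlg Q hQQ j j' hj, Complex.exp_add,
            Complex.exp_log (hPQ _ _), Complex.exp_pi_mul_I]
          simp)
      exact ⟨n, fun _ => hn⟩
  choose n hn using hn
  choose m hm using hm
  have key : ∀ i i' j j', i < i' → j ≠ j' →
      (1 : ℤ) + (if j < j' then 1 else -1) =
        2 * (n i i' j' + m j' i j - n i' i j - m j i' j') := by
    intro i i' j j' hi hj
    have h := rel i i' j j' hi.ne hj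
    rw [hn i' i j hi.ne, hm j i' j' hj.symm, hn i i' j' hi.ne', hm j' i j hj] at h
    have hpi : (Real.pi * Complex.I : ℂ) ≠ 0 :=
      mul_ne_zero (Complex.ofReal_ne_zero.2 Real.pi_ne_zero) Complex.I_ne_zero
    have e1 : lg P i' i = lg P i i' + Real.pi * Complex.I := by
      simp [lg, hi, hi.not_gt]
    have e2 : lg Q j' j = lg Q j j' + (if j < j' then 1 else -1) * (Real.pi * Complex.I) := by
      rcases lt_or_gt_of_ne hj with h | h <;> simp [lg, h, h.not_gt]
    rw [e1, e2] at h
    have h' : ((1 : ℂ) + (if j < j' then 1 else -1)) * (Real.pi * Complex.I) =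
        (2 * (n i i' j' + m j' i j - n i' i j - m j i' j')) * (Real.pi * Complex.I) := by
      linear_combination h
    have h'' := mul_right_cancel₀ hpi h'
    split_ifs at h'' ⊢ <;> exact_mod_cast h''
  have h1 := fun i i' h => key i i' 0 1 h (by decide)
  have h2 := fun i i' h => key i i' 0 2 h (by decide)
  have h3 := fun i i' h => key i i' 1 2 h (by decide)
  have h4 := fun i i' h => key i i' 1 0 h (by decide)
  have h5 := fun i i' h => key i i' 2 0 h (by decide)
  have h6 := fun i i' h => key i i' 2 1 h (by decide)
  simp only [Fin.isValue, show (0 : Fin 3) < 1 by decide, show (0 : Fin 3) < 2 by decide,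
    show (1 : Fin 3) < 2 by decide, show ¬ (1 : Fin 3) < 0 by decide,
    show ¬ (2 : Fin 3) < 0 by decide, show ¬ (2 : Fin 3) < 1 by decide, if_true, if_false]
    at h1 h2 h3 h4 h5 h6
  have c1 : (0 : Fin 3) < 1 := by decide
  have c2 : (0 : Fin 3) < 2 := by decide
  have c3 : (1 : Fin 3) < 2 := by decide
  have := h1 0 1 c1
  have := h1 0 2 c2
  have := h1 1 2 c3
  have := h2 0 1 c1
  have := h2 0 2 c2
  have := h2 1 2 c3
  have := h3 0 1 c1
  have := h3 0 2 c2
  have := h3 1 2 c3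
  have := h4 0 1 c1
  have := h4 0 2 c2
  have := h4 1 2 c3
  have := h5 0 1 c1
  have := h5 0 2 c2
  have := h5 1 2 c3
  have := h6 0 1 c1
  have := h6 0 2 c2
  have := h6 1 2 c3
  omega

/-- Joining each `P i` to each `Q j` inside sets `F i j`, two sets with independent indices meet. -/
theorem exists_independent_joinedIn_meet (P Q : Fin 3 → ℝ × ℝ) (F : Fin 3 → Fin 3 → Set (ℝ × ℝ))
    (h : ∀ i j, JoinedIn (F i j) (P i) (Q j)) :
    ∃ i i' j j', i ≠ i' ∧ j ≠ j' ∧ ∃ p, p ∈ F i j ∧ p ∈ F i' j' := by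
  obtain ⟨i, i', j, j', hi, hj, s, t, hst⟩ := exists_independent_paths_meet _ _
    (fun i j => (h i j).somePath.map Complex.equivRealProdCLM.symm.continuous)
  refine ⟨i, i', j, j', hi, hj, (h i j).somePath s, (h i j).somePath_mem s, ?_⟩
  rw [Complex.equivRealProdCLM.symm.injective hst]
  exact (h i' j').somePath_mem t

namespace Drawing

variable {V : Type} {G : SimpleGraph V}

/-- The union of the arcs of a set of edges. -/
def region (Γ : Drawing G) (S : Set (Sym2 V)) : Set (ℝ × ℝ) := {p | ∃ e ∈ S, p ∈ Γ.img e}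

lemma joinedIn_region (Γ : Drawing G) {S : Set (Sym2 V)} {u v : V} (h : G.Adj u v)
    (hS : s(u, v) ∈ S) : JoinedIn (Γ.region S) (Γ.vpos u) (Γ.vpos v) :=
  JoinedIn.ofLine (Γ.arc_cont u v h) (Γ.arc_start u v h) (Γ.arc_end u v h)
    fun _ hp => ⟨s(u, v), hS, hp⟩

lemma mem_of_vpos_mem_img (Γ : Drawing G) {e : Sym2 V} (he : e ∈ G.edgeSet) {v : V}
    (h : Γ.vpos v ∈ Γ.img e) : v ∈ e := by
  induction e with | _ a b
  obtain ⟨t, ht, htv⟩ := h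
  have hab : G.Adj a b := he
  rcases eq_or_lt_of_le ht.1 with h0 | h0
  · rw [← h0, Γ.arc_start a b hab] at htv
    exact Sym2.mem_iff.2 (Or.inl (Γ.vpos_inj htv).symm)
  rcases eq_or_lt_of_le ht.2 with h1 | h1
  · rw [h1, Γ.arc_end a b hab] at htv
    exact Sym2.mem_iff.2 (Or.inr (Γ.vpos_inj htv).symm)
  · exact (Γ.arc_avoids a b hab t ⟨h0, h1⟩ ⟨v, htv.symm⟩).elim

lemma Crossing.symm {Γ : Drawing G} {e f : Sym2 V} {p : ℝ × ℝ} (h : Γ.Crossing e f p) :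
    Γ.Crossing f e p :=
  ⟨h.2.1, h.1, h.2.2.1.symm, h.2.2.2.2.1, h.2.2.2.1, h.2.2.2.2.2⟩

lemma Crosses.symm {Γ : Drawing G} {e f : Sym2 V} (h : Γ.Crosses e f) : Γ.Crosses f e :=
  h.imp fun _ => Crossing.symm

/-- A family of edges of a drawing realising a subdivision of `K₃,₃` contains a crossing. -/
lemma exists_crossing_of_subdivision (Γ : Drawing G) {S : Set (Sym2 V)} (hS : S ⊆ G.edgeSet)
    (A B : Fin 3 → V) (U : Fin 3 → Fin 3 → Set V)
    (hU : ∀ i i' j j', i ≠ i' → j ≠ j' → Disjoint (U i j) (U i' j'))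
    (h : ∀ i j, JoinedIn (Γ.region {e ∈ S | ∀ v ∈ e, v ∈ U i j}) (Γ.vpos (A i)) (Γ.vpos (B j))) :
    ∃ e ∈ S, ∃ f ∈ S, ∃ p, Γ.Crossing e f p := by
  obtain ⟨i, i', j, j', hi, hj, p, ⟨e, ⟨heS, heU⟩, hpe⟩, ⟨f, ⟨hfS, hfU⟩, hpf⟩⟩ :=
    exists_independent_joinedIn_meet _ _ _ h
  have hd : ∀ v, v ∈ e → v ∈ f → False := fun v hve hvf =>
    Set.disjoint_left.1 (hU i i' j j' hi hj) (heU v hve) (hfU v hvf)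
  refine ⟨e, heS, f, hfS, p, hS heS, hS hfS, ?_, hpe, hpf, ?_⟩
  · rintro rfl
    exact hd _ e.out_fst_mem e.out_fst_mem
  · rintro ⟨v, rfl⟩
    exact hd v (Γ.mem_of_vpos_mem_img (hS heS) hpe) (Γ.mem_of_vpos_mem_img (hS hfS) hpf)

lemma crossingSet_finite [Finite V] (Γ : Drawing G) : Γ.crossingSet.Finite := by
  have hfin : (⋃ q : {q : Sym2 V × Sym2 V // q.1 ∈ G.edgeSet ∧ q.2 ∈ G.edgeSet ∧ q.1 ≠ q.2},
      Γ.img q.1.1 ∩ Γ.img q.1.2).Finite := by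
    refine Set.finite_iUnion ?_
    rintro ⟨⟨e, f⟩, he, hf, hne⟩
    induction e with | _ a b
    induction f with | _ c d
    exact Γ.inter_finite a b c d he hf hne
  refine hfin.subset ?_
  rintro p ⟨e, f, he, hf, hne, hpe, hpf, -⟩
  exact Set.mem_iUnion.2 ⟨⟨(e, f), he, hf, hne⟩, hpe, hpf⟩

lemma eq_of_mem_img_of_crossing (Γ : Drawing G) {e f g : Sym2 V} {p : ℝ × ℝ}
    (h : Γ.Crossing e f p) (hg : g ∈ G.edgeSet) (hp : p ∈ Γ.img g) : g = e ∨ g = f := by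
  by_contra! hne
  obtain ⟨he, hf, hef, hpe, hpf, hv⟩ := h
  induction e with | _ a b
  induction f with | _ c d
  induction g with | _ x y
  exact Γ.no_triple_point p hv a b c d x y he hf hg hef hne.1.symm hne.2.symm ⟨hpe, hpf, hp⟩

/-- If each of `m` disjoint edge sets `C t` has an edge crossing an edge of `C t ∪ D`, where `D` is
disjoint from all of them, then there are at least `m` crossings. -/
lemma le_crossings_of_disjoint [Finite V] (Γ : Drawing G) {m : ℕ} (C : Fin m → Set (Sym2 V))
    (D : Set (Sym2 V)) (hC : ∀ t t' e, e ∈ C t → e ∈ C t' → t = t') (hD : ∀ t, ∀ e ∈ C t, e ∉ D)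
    (h : ∀ t, ∃ e ∈ C t, ∃ f ∈ C t ∪ D, ∃ p, Γ.Crossing e f p) : m ≤ Γ.crossings := by
  choose e he f hf p hp using h
  have hinj : Function.Injective p := by
    intro t t' htt
    have hcr := hp t
    rcases Γ.eq_of_mem_img_of_crossing (hp t) (hp t').1 (htt ▸ (hp t').2.2.2.1) with h | h
    · exact hC _ _ _ (he t) (h ▸ he t')
    · rcases hf t with hf | hf
      · exact hC _ _ _ hf (h ▸ he t')
      · exact (hD t' _ (he t') (h ▸ hf)).elim
  calc m = (Set.range p).ncard := by rw [Set.ncard_range_of_injective hinj, Nat.card_fin]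
    _ ≤ Γ.crossings := Set.ncard_le_ncard
      (by rintro _ ⟨t, rfl⟩; exact ⟨_, _, hp t⟩) Γ.crossingSet_finite

end Drawing

/-- Two distinct parabolic arcs over `[u, v]` and `[w, z]` meeting off the axis lie on the same side
of it, and the intervals interleave. -/
lemma interleave_of_parabolas_meet {u v w z x y σ τ : ℝ} (huv : u < v) (hwz : w < z)
    (hne : ¬ (u = w ∧ v = z)) (hσ : σ = 1 ∨ σ = -1) (hτ : τ = 1 ∨ τ = -1)
    (h1 : 0 ≤ (x - u) * (v - x)) (h2 : 0 ≤ (x - w) * (z - x))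
    (h3 : y = σ * ((x - u) * (v - x))) (h4 : y = τ * ((x - w) * (z - x))) (hy : y ≠ 0) :
    σ = τ ∧ (x - u) * (v - x) = (x - w) * (z - x) ∧
      (u < w ∧ w < v ∧ v < z ∨ w < u ∧ u < z ∧ z < v) := by
  have h1' : 0 < (x - u) * (v - x) := lt_of_le_of_ne h1 fun h => hy (by rw [h3, ← h, mul_zero])
  have h2' : 0 < (x - w) * (z - x) := lt_of_le_of_ne h2 fun h => hy (by rw [h4, ← h, mul_zero])
  have hst : σ = τ := by
    rcases hσ with rfl | rfl <;> rcases hτ with rfl | rfl <;> first | rfl | (exfalso; linarith)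
  have heq : (x - u) * (v - x) = (x - w) * (z - x) := by
    rcases hτ with rfl | rfl <;> subst hst <;> linarith
  have bd : ∀ {a b : ℝ}, a < b → 0 < (x - a) * (b - x) → a < x ∧ x < b := by
    intro a b hab h
    rcases pos_and_pos_or_neg_and_neg_of_mul_pos h with h | h
    · constructor <;> linarith
    · exfalso; linarith
  obtain ⟨hu, hv⟩ := bd huv h1'
  obtain ⟨hw, hz⟩ := bd hwz h2'
  refine ⟨hst, heq, ?_⟩
  rcases lt_trichotomy u w with h | h | h
  · refine Or.inl ⟨h, by linarith, ?_⟩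
    by_contra! hc
    nlinarith [mul_pos (sub_pos.2 h) (sub_pos.2 hz), mul_nonneg (sub_pos.2 hu).le (sub_nonneg.2 hc)]
  · subst h
    refine (hne ⟨rfl, ?_⟩).elim
    have := mul_left_cancel₀ (sub_pos.2 hu).ne' heq
    linarith
  · refine Or.inr ⟨h, by linarith, ?_⟩
    by_contra! hc
    nlinarith [mul_pos (sub_pos.2 h) (sub_pos.2 hv), mul_nonneg (sub_pos.2 hw).le (sub_nonneg.2 hc)]

/-- The side of the axis on which the edge `uv` is drawn, `dn` being the set of lower edges. -/
def pageSign (dn : ℕ → ℕ → Prop) (u v : ℕ) : ℝ :=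
  open Classical in if dn (min u v) (max u v) then -1 else 1

lemma pageSign_comm (dn : ℕ → ℕ → Prop) (u v : ℕ) : pageSign dn u v = pageSign dn v u := by
  rw [pageSign, min_comm, max_comm, pageSign]

lemma pageSign_eq_or (dn : ℕ → ℕ → Prop) (u v : ℕ) :
    pageSign dn u v = 1 ∨ pageSign dn u v = -1 := by
  unfold pageSign; split_ifs <;> simp

lemma pageSign_eq_iff {dn : ℕ → ℕ → Prop} {u v w z : ℕ} (huv : u < v) (hwz : w < z) :
    pageSign dn u v = pageSign dn w z ↔ (dn u v ↔ dn w z) := by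
  unfold pageSign
  rw [min_eq_left huv.le, max_eq_right huv.le, min_eq_left hwz.le, max_eq_right hwz.le]
  split_ifs <;> norm_num <;> tauto

/-- The parabolic arc from `(u, 0)` to `(v, 0)`. -/
def parabola (dn : ℕ → ℕ → Prop) (u v : ℕ) (t : ℝ) : ℝ × ℝ :=
  (u + t * (v - u), pageSign dn u v * (t * (1 - t) * (v - u) ^ 2))

lemma mem_parabola {dn : ℕ → ℕ → Prop} {u v : ℕ} {p : ℝ × ℝ}
    (h : p ∈ parabola dn u v '' Set.Icc 0 1) :
    0 ≤ (p.1 - u) * (v - p.1) ∧ p.2 = pageSign dn u v * ((p.1 - u) * (v - p.1)) := by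
  obtain ⟨t, ht, rfl⟩ := h
  have e : ((u : ℝ) + t * (v - u) - u) * (v - (u + t * (v - u))) = t * (1 - t) * (v - u) ^ 2 := by
    ring
  simp only [parabola, e, and_true]
  exact mul_nonneg (mul_nonneg ht.1 (by linarith [ht.2])) (sq_nonneg _)

lemma parabola_swap (dn : ℕ → ℕ → Prop) (u v : ℕ) (t : ℝ) :
    parabola dn u v t = parabola dn v u (1 - t) := by
  unfold parabola
  rw [pageSign_comm]
  ext <;> ring

/-- A common point of two parabolic arcs lying on the axis is an end of the first arc. -/
lemma eq_end_of_mem_parabola {dn : ℕ → ℕ → Prop} {u v : ℕ} {p : ℝ × ℝ}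
    (h : p ∈ parabola dn u v '' Set.Icc 0 1) (h0 : p.2 = 0) :
    p = ((u : ℝ), 0) ∨ p = ((v : ℝ), 0) := by
  obtain ⟨-, h2⟩ := mem_parabola h
  rw [h0, eq_comm, mul_eq_zero] at h2
  have hs : pageSign dn u v ≠ 0 := by rcases pageSign_eq_or dn u v with h | h <;> rw [h] <;> norm_num
  rcases mul_eq_zero.1 (h2.resolve_left hs) with h | h
  · exact Or.inl (Prod.ext (by simp; linarith) h0)
  · exact Or.inr (Prod.ext (by simp; linarith) h0)

lemma parabolas_meet {dn : ℕ → ℕ → Prop} {u v w z : ℕ} (huv : u < v) (hwz : w < z)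
    (hne : ¬ (u = w ∧ v = z)) {p : ℝ × ℝ} (h1 : p ∈ parabola dn u v '' Set.Icc 0 1)
    (h2 : p ∈ parabola dn w z '' Set.Icc 0 1) (hp : p.2 ≠ 0) :
    (dn u v ↔ dn w z) ∧ (p.1 - u) * (v - p.1) = (p.1 - w) * (z - p.1) ∧
      (u < w ∧ w < v ∧ v < z ∨ w < u ∧ u < z ∧ z < v) := by
  obtain ⟨a1, a2⟩ := mem_parabola h1
  obtain ⟨b1, b2⟩ := mem_parabola h2
  obtain ⟨c1, c2, c3⟩ := interleave_of_parabolas_meet (Nat.cast_lt.2 huv) (Nat.cast_lt.2 hwz)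
    (by simpa using hne) (pageSign_eq_or dn u v) (pageSign_eq_or dn w z) a1 b1 a2 b2 hp
  exact ⟨(pageSign_eq_iff huv hwz).1 c1, c2, by simpa using c3⟩

lemma parabolas_meet_unique {dn : ℕ → ℕ → Prop} {u v w z : ℕ} (huv : u < v) (hwz : w < z)
    (hne : ¬ (u = w ∧ v = z)) {p q : ℝ × ℝ} (h1 : p ∈ parabola dn u v '' Set.Icc 0 1)
    (h2 : p ∈ parabola dn w z '' Set.Icc 0 1) (hp : p.2 ≠ 0)
    (h3 : q ∈ parabola dn u v '' Set.Icc 0 1)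
    (h4 : q ∈ parabola dn w z '' Set.Icc 0 1) (hq : q.2 ≠ 0) : p = q := by
  obtain ⟨-, hx, ho⟩ := parabolas_meet huv hwz hne h1 h2 hp
  obtain ⟨-, hy, -⟩ := parabolas_meet huv hwz hne h3 h4 hq
  have hs : ((u : ℝ) + v - w - z) ≠ 0 := by
    rcases ho with ⟨a, -, b⟩ | ⟨a, -, b⟩
    · have := Nat.cast_lt (α := ℝ).2 a; have := Nat.cast_lt (α := ℝ).2 b
      exact ne_of_lt (by linarith)
    · have := Nat.cast_lt (α := ℝ).2 a; have := Nat.cast_lt (α := ℝ).2 b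
      exact ne_of_gt (by linarith)
  have h : p.1 = q.1 := mul_left_cancel₀ hs (by linear_combination hx - hy)
  exact Prod.ext h (by rw [(mem_parabola h1).2, (mem_parabola h3).2, h])

/-- The intersection of two parabolic arcs with different ends is finite. -/
lemma parabolas_inter_finite {dn : ℕ → ℕ → Prop} {u v w z : ℕ} (huv : u < v) (hwz : w < z)
    (hne : ¬ (u = w ∧ v = z)) :
    (parabola dn u v '' Set.Icc 0 1 ∩ parabola dn w z '' Set.Icc 0 1).Finite := by
  have h1 : {p | p ∈ parabola dn u v '' Set.Icc 0 1 ∩ parabola dn w z '' Set.Icc 0 1 ∧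
      p.2 ≠ 0}.Finite :=
    Set.Subsingleton.finite fun p hp q hq =>
      parabolas_meet_unique huv hwz hne hp.1.1 hp.1.2 hp.2 hq.1.1 hq.1.2 hq.2
  refine (h1.union (Set.toFinite {((u : ℝ), (0 : ℝ)), ((v : ℝ), 0)})).subset fun p hp => ?_
  by_cases h0 : p.2 = 0
  · exact Or.inr (eq_end_of_mem_parabola hp.1 h0)
  · exact Or.inl ⟨hp, h0⟩

lemma parabola_image_swap (dn : ℕ → ℕ → Prop) (u v : ℕ) :
    parabola dn u v '' Set.Icc 0 1 = parabola dn v u '' Set.Icc 0 1 := by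
  have key : ∀ a b, parabola dn a b '' Set.Icc 0 1 ⊆ parabola dn b a '' Set.Icc 0 1 := by
    rintro a b p ⟨t, ht, rfl⟩
    exact ⟨1 - t, ⟨by linarith [ht.2], by linarith [ht.1]⟩, (parabola_swap dn a b t).symm⟩
  exact (key u v).antisymm (key v u)

section Book

variable {n : ℕ} (G : SimpleGraph (Fin n)) (dn special : ℕ → ℕ → Prop)

/-- Interleaving edges on the same side of the spine consist of one special and one ordinary
edge. -/
def SpecialInterleaving : Prop :=
  ∀ u v w z : Fin n, G.Adj u v → G.Adj w z → u < w → w < v → v < z →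
    (dn u v ↔ dn w z) → (special u v ↔ ¬ special w z)

variable {G dn special}

lemma exists_sorted_of_mem_edgeSet {e : Sym2 (Fin n)} (he : e ∈ G.edgeSet) :
    ∃ u v : Fin n, u < v ∧ G.Adj u v ∧ e = s(u, v) := by
  induction e with | _ a b
  have hab : G.Adj a b := he
  rcases lt_or_gt_of_ne hab.ne with h | h
  · exact ⟨a, b, h, hab, rfl⟩
  · exact ⟨b, a, h, hab.symm, Sym2.eq_swap⟩

/-- The two-page book drawing: vertices on the axis in their natural order, and edges as parabolic
arcs, below the axis for those in `dn` and above it otherwise. -/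
def bookDrawing (hX : SpecialInterleaving G dn special) : Drawing G where
  vpos v := ((v : ℕ), 0)
  vpos_inj u v h := by simpa [Fin.ext_iff] using h
  arc u v := parabola dn u v
  arc_symm u v t := parabola_swap dn u v t
  arc_cont u v _ := by unfold parabola; fun_prop
  arc_injOn u v h := by
    intro s _ t _ hst
    have hne : ((v : ℕ) : ℝ) - (u : ℕ) ≠ 0 := by
      rw [sub_ne_zero]
      simpa [Fin.ext_iff] using h.ne'
    have := congrArg Prod.fst hst
    simp only [parabola] at this
    exact mul_right_cancel₀ hne (by linarith)
  arc_start u v _ := by simp [parabola]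
  arc_end u v _ := by simp [parabola]
  arc_avoids u v h := by
    rintro t ht ⟨w, hw⟩
    have h2 := congrArg Prod.snd hw
    simp only [parabola] at h2
    have hne : ((v : ℕ) : ℝ) - (u : ℕ) ≠ 0 := by
      rw [sub_ne_zero]
      simpa [Fin.ext_iff] using h.ne'
    have hpos : 0 < t * (1 - t) * (((v : ℕ) : ℝ) - (u : ℕ)) ^ 2 :=
      mul_pos (mul_pos ht.1 (by linarith [ht.2])) (by positivity)
    rcases pageSign_eq_or dn u v with h | h <;> rw [h] at h2 <;> linarith
  inter_finite u v w z h h' hne := by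
    wlog huv : u < v generalizing u v
    · rw [parabola_image_swap]
      exact this v u h.symm (by rwa [Sym2.eq_swap]) (lt_of_le_of_ne (not_lt.1 huv) h.ne')
    wlog hwz : w < z generalizing w z
    · rw [parabola_image_swap dn w z]
      exact this z w h'.symm (by rwa [Sym2.eq_swap (a := z)])
        (lt_of_le_of_ne (not_lt.1 hwz) h'.ne')
    refine parabolas_inter_finite huv hwz fun hh => hne ?_
    rw [Fin.ext hh.1, Fin.ext hh.2]
  no_triple_point := by
    have key : ∀ p : ℝ × ℝ, p ∉ Set.range (fun v : Fin n => (((v : ℕ) : ℝ), (0 : ℝ))) →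
        ∀ u v w z : Fin n, u < v → w < z → G.Adj u v → G.Adj w z → s(u, v) ≠ s(w, z) →
        p ∈ parabola dn u v '' Set.Icc 0 1 → p ∈ parabola dn w z '' Set.Icc 0 1 →
        (special u v ↔ ¬ special w z) := by
      intro p hp u v w z huv hwz h h' hne h1 h2
      have h0 : p.2 ≠ 0 := by
        intro h0
        rcases eq_end_of_mem_parabola h1 h0 with h | h
        · exact hp ⟨u, h.symm⟩
        · exact hp ⟨v, h.symm⟩
      obtain ⟨hd, -, ho⟩ := parabolas_meet huv hwz
        (fun hh => hne (by rw [Fin.ext hh.1, Fin.ext hh.2])) h1 h2 h0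
      rcases ho with ⟨a, b, c⟩ | ⟨a, b, c⟩
      · exact hX u v w z h h' a b c hd
      · have := hX w z u v h' h a b c hd.symm
        tauto
    intro p hp u₁ v₁ u₂ v₂ u₃ v₃ h₁ h₂ h₃ h₁₂ h₁₃ h₂₃ ⟨m₁, m₂, m₃⟩
    have sort : ∀ u v : Fin n, G.Adj u v → p ∈ parabola dn u v '' Set.Icc 0 1 →
        ∃ a b : Fin n, a < b ∧ G.Adj a b ∧ s(u, v) = s(a, b) ∧
          p ∈ parabola dn a b '' Set.Icc 0 1 := by
      intro u v h hm
      rcases lt_or_gt_of_ne h.ne with hlt | hlt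
      · exact ⟨u, v, hlt, h, rfl, hm⟩
      · exact ⟨v, u, hlt, h.symm, Sym2.eq_swap, by rwa [parabola_image_swap]⟩
    obtain ⟨a₁, b₁, l₁, d₁, e₁, n₁⟩ := sort u₁ v₁ h₁ m₁
    obtain ⟨a₂, b₂, l₂, d₂, e₂, n₂⟩ := sort u₂ v₂ h₂ m₂
    obtain ⟨a₃, b₃, l₃, d₃, e₃, n₃⟩ := sort u₃ v₃ h₃ m₃
    rw [e₁, e₂] at h₁₂
    rw [e₁, e₃] at h₁₃
    rw [e₂, e₃] at h₂₃
    have k₁ := key p hp _ _ _ _ l₁ l₂ d₁ d₂ h₁₂ n₁ n₂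
    have k₂ := key p hp _ _ _ _ l₁ l₃ d₁ d₃ h₁₃ n₁ n₃
    have k₃ := key p hp _ _ _ _ l₂ l₃ d₂ d₃ h₂₃ n₂ n₃
    tauto

variable (hX : SpecialInterleaving G dn special)

lemma mem_parabola_of_bookDrawing_crossing {u v w z : Fin n} {p : ℝ × ℝ}
    (h : (bookDrawing hX).Crossing s(u, v) s(w, z) p) :
    ¬ ((u : ℕ) = w ∧ (v : ℕ) = z) ∧ p ∈ parabola dn u v '' Set.Icc 0 1 ∧
      p ∈ parabola dn w z '' Set.Icc 0 1 ∧ p.2 ≠ 0 := by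
  obtain ⟨-, -, hne, h1, h2, hp⟩ := h
  refine ⟨fun hh => hne (by rw [Fin.ext hh.1, Fin.ext hh.2]), h1, h2, fun h0 => ?_⟩
  rcases eq_end_of_mem_parabola h1 h0 with h | h
  · exact hp ⟨u, h.symm⟩
  · exact hp ⟨v, h.symm⟩

/-- Edges crossing in a book drawing interleave on the same page. -/
lemma exists_interleaving_of_bookDrawing_crossing {e f : Sym2 (Fin n)} {p : ℝ × ℝ}
    (h : (bookDrawing hX).Crossing e f p) :
    ∃ u v w z : Fin n, G.Adj u v ∧ G.Adj w z ∧ u < w ∧ w < v ∧ v < z ∧ (dn u v ↔ dn w z) ∧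
      (e = s(u, v) ∧ f = s(w, z) ∨ f = s(u, v) ∧ e = s(w, z)) := by
  obtain ⟨u, v, huv, hA, rfl⟩ := exists_sorted_of_mem_edgeSet h.1
  obtain ⟨w, z, hwz, hB, rfl⟩ := exists_sorted_of_mem_edgeSet h.2.1
  obtain ⟨hne, h1, h2, h0⟩ := mem_parabola_of_bookDrawing_crossing hX h
  obtain ⟨hd, -, ⟨a, b, c⟩ | ⟨a, b, c⟩⟩ := parabolas_meet huv hwz hne h1 h2 h0
  · exact ⟨u, v, w, z, hA, hB, a, b, c, hd, Or.inl ⟨rfl, rfl⟩⟩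
  · exact ⟨w, z, u, v, hB, hA, a, b, c, hd.symm, Or.inr ⟨rfl, rfl⟩⟩

/-- Two edges of a book drawing cross at most once. -/
lemma bookDrawing_crossing_unique {e f : Sym2 (Fin n)} {p q : ℝ × ℝ}
    (hp : (bookDrawing hX).Crossing e f p) (hq : (bookDrawing hX).Crossing e f q) : p = q := by
  obtain ⟨u, v, huv, hA, rfl⟩ := exists_sorted_of_mem_edgeSet hp.1
  obtain ⟨w, z, hwz, hB, rfl⟩ := exists_sorted_of_mem_edgeSet hp.2.1
  obtain ⟨hne, h1, h2, h0⟩ := mem_parabola_of_bookDrawing_crossing hX hp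
  obtain ⟨-, h3, h4, h5⟩ := mem_parabola_of_bookDrawing_crossing hX hq
  exact parabolas_meet_unique huv hwz hne h1 h2 h0 h3 h4 h5

end Book

section GridGraph

/-- The left end of the bundle containing the vertex `v`. -/
def bundleLeft (ℓ v : ℕ) : ℕ := if v < 3 * ℓ then 0 else v / ℓ * ℓ

/-- The right end of the bundle containing the vertex `v`. -/
def bundleRight (k l ℓ v : ℕ) : ℕ :=
  if v < ℓ then (5 + k + l) * ℓ else if v < 2 * ℓ then (4 + k) * ℓ else (v / ℓ + 1) * ℓ

/-- The edges, written with the smaller end first, of the `t`-th path of every bundle. -/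
def CopyEdge (k l ℓ t u v : ℕ) : Prop :=
  u < v ∧ (u < (5 + k + l) * ℓ ∧ v = bundleRight k l ℓ u ∧ u % ℓ = t ∨
    v < (5 + k + l) * ℓ ∧ u = bundleLeft ℓ v ∧ v % ℓ = t)

/-- The edges of the first star. -/
def StarEdgeA (k l ℓ u v : ℕ) : Prop := (∃ i < k, u = (4 + i) * ℓ) ∧ v = (5 + k + l) * ℓ

/-- The edges of the second star. -/
def StarEdgeB (k l ℓ u v : ℕ) : Prop := u = 3 * ℓ ∧ ∃ j < l, v = (5 + k + j) * ℓ

/-- The edges of `gridGraph`, written with the smaller end first. -/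
def GridEdge (k l ℓ u v : ℕ) : Prop :=
  u < v ∧ ((∃ t < ℓ, CopyEdge k l ℓ t u v) ∨ StarEdgeA k l ℓ u v ∨ StarEdgeB k l ℓ u v)

/-- The graph formed by two stars with `k` and `l` edges whose ends interleave on a cycle of
bundles of `ℓ` paths, together with an inner vertex attached to that cycle by three further
bundles. -/
def gridGraph (k l ℓ n : ℕ) : SimpleGraph (Fin n) where
  Adj u v := GridEdge k l ℓ u v ∨ GridEdge k l ℓ v u
  symm := ⟨fun _ _ h => h.symm⟩
  loopless := ⟨fun _ h => by rcases h with h | h <;> exact lt_irrefl _ h.1⟩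

variable {k l ℓ : ℕ}

lemma gridEdge_of_adj {n : ℕ} {u v : Fin n} (h : (gridGraph k l ℓ n).Adj u v) (huv : u < v) :
    GridEdge k l ℓ u v := by
  rcases h with h | h
  · exact h
  · exact absurd h.1 (not_lt.2 (le_of_lt huv))

lemma bundleLeft_gap {m v : ℕ} (hm : 3 ≤ m) (h1 : bundleLeft ℓ v < m * ℓ)
    (h2 : m * ℓ < v) : False := by
  have h3 : 3 * ℓ ≤ m * ℓ := Nat.mul_le_mul_right _ hm
  unfold bundleLeft at h1
  split_ifs at h1 with h
  · omega
  · have hlt : v / ℓ < m := lt_of_mul_lt_mul_right h1 (Nat.zero_le _)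
    have hpos : 0 < ℓ := Nat.pos_of_ne_zero (by rintro rfl; simp at h1)
    have := Nat.div_lt_iff_lt_mul hpos |>.1 hlt
    omega

lemma bundleLeft_interleave {v z : ℕ} (h1 : bundleLeft ℓ v < bundleLeft ℓ z)
    (h2 : bundleLeft ℓ z < v) (hℓ : 0 < ℓ) : False := by
  by_cases hz : z < 3 * ℓ
  · rw [bundleLeft, bundleLeft, if_pos hz] at h1; omega
  · have e : bundleLeft ℓ z = z / ℓ * ℓ := if_neg hz
    rw [e] at h1 h2
    exact bundleLeft_gap ((Nat.le_div_iff_mul_le hℓ).2 (not_lt.1 hz)) h1 h2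

lemma bundleRight_le {w : ℕ} (hℓ : 0 < ℓ) (hw : w < (5 + k + l) * ℓ) :
    bundleRight k l ℓ w ≤ (5 + k + l) * ℓ := by
  unfold bundleRight
  split_ifs
  · exact le_rfl
  · exact Nat.mul_le_mul_right _ (by omega)
  · exact Nat.mul_le_mul_right _ ((Nat.div_lt_iff_lt_mul hℓ).2 hw)

lemma bundleRight_interleave {u w : ℕ} (hℓ : 0 < ℓ) (hw : w < (5 + k + l) * ℓ) (h1 : u < w)
    (h2 : w < bundleRight k l ℓ u) : bundleRight k l ℓ w ≤ bundleRight k l ℓ u := by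
  by_cases hu : u < ℓ
  · have e : bundleRight k l ℓ u = (5 + k + l) * ℓ := if_pos hu
    rw [e]; exact bundleRight_le hℓ hw
  have hw1 : ¬ w < ℓ := by omega
  by_cases hu2 : u < 2 * ℓ
  · have e : bundleRight k l ℓ u = (4 + k) * ℓ := by simp [bundleRight, hu, hu2]
    rw [e] at h2 ⊢
    unfold bundleRight
    rw [if_neg hw1]
    split_ifs
    · exact le_rfl
    · exact Nat.mul_le_mul_right _ ((Nat.div_lt_iff_lt_mul hℓ).2 h2)
  · have e : ∀ {x}, u ≤ x → bundleRight k l ℓ x = (x / ℓ + 1) * ℓ := fun {x} hx => by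
      rw [bundleRight, if_neg (by omega), if_neg (by omega)]
    rw [e le_rfl] at h2 ⊢
    rw [e h1.le]
    exact Nat.mul_le_mul_right _ ((Nat.div_lt_iff_lt_mul hℓ).2 h2)

lemma bundleRight_ne_of_eq_bundleLeft {u v : ℕ} (hℓ : 0 < ℓ)
    (hv : v < (5 + k + l) * ℓ) (h : u = bundleLeft ℓ v) : v ≠ bundleRight k l ℓ u := by
  intro hr
  unfold bundleLeft at h
  split_ifs at h with h3
  · rw [h, bundleRight, if_pos hℓ] at hr; omega
  · have h3' := (Nat.le_div_iff_mul_le hℓ).2 (not_lt.1 h3)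
    have hu : 3 * ℓ ≤ u := h ▸ Nat.mul_le_mul_right _ h3'
    rw [bundleRight, if_neg (by omega), if_neg (by omega), h, Nat.mul_div_cancel _ hℓ] at hr
    have := Nat.lt_div_mul_add hℓ (a := v)
    rw [add_mul] at hr
    omega

lemma not_bundleRight_of_starEdgeA {u v : ℕ} (hℓ : 0 < ℓ) (h : StarEdgeA k l ℓ u v) :
    v ≠ bundleRight k l ℓ u := by
  obtain ⟨⟨i, hi, rfl⟩, rfl⟩ := h
  have : 4 * ℓ ≤ (4 + i) * ℓ := Nat.mul_le_mul_right _ (by omega)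
  rw [bundleRight, if_neg (by omega), if_neg (by omega), Nat.mul_div_cancel _ hℓ]
  intro h
  have := Nat.eq_of_mul_eq_mul_right hℓ h
  omega

lemma not_bundleRight_of_starEdgeB {u v : ℕ} (hℓ : 0 < ℓ) (h : StarEdgeB k l ℓ u v) :
    v ≠ bundleRight k l ℓ u := by
  obtain ⟨rfl, j, hj, rfl⟩ := h
  rw [bundleRight, if_neg (by omega), if_neg (by omega), Nat.mul_div_cancel _ hℓ]
  intro h
  have := Nat.eq_of_mul_eq_mul_right hℓ h
  omega

lemma not_starEdgeB_of_starEdgeA {u v : ℕ} (hℓ : 0 < ℓ) (h : StarEdgeA k l ℓ u v) :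
    ¬ StarEdgeB k l ℓ u v := by
  rintro ⟨rfl, -⟩
  obtain ⟨⟨i, -, hi⟩, -⟩ := h
  have := Nat.eq_of_mul_eq_mul_right hℓ hi
  omega

/-- Among the edges of `gridGraph` above the axis, only edges of different stars interleave. -/
lemma starEdges_of_interleave_up {u v w z : ℕ} (hℓ : 0 < ℓ) (h : GridEdge k l ℓ u v)
    (h' : GridEdge k l ℓ w z) (huw : u < w) (hwv : w < v) (hvz : v < z)
    (hr : v ≠ bundleRight k l ℓ u) (hr' : z ≠ bundleRight k l ℓ w) :
    StarEdgeB k l ℓ u v ∧ StarEdgeA k l ℓ w z := by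
  have kinds : ∀ {a b}, GridEdge k l ℓ a b → b ≠ bundleRight k l ℓ a →
      (b < (5 + k + l) * ℓ ∧ a = bundleLeft ℓ b) ∨ StarEdgeA k l ℓ a b ∨ StarEdgeB k l ℓ a b := by
    rintro a b ⟨-, ⟨t, -, -, ⟨-, h, -⟩ | ⟨h1, h2, -⟩⟩ | h⟩ hr
    · exact (hr h).elim
    · exact Or.inl ⟨h1, h2⟩
    · exact Or.inr h
  rcases kinds h hr with ⟨h1, rfl⟩ | hA | hB
  · rcases kinds h' hr' with ⟨h2, rfl⟩ | ⟨⟨i, hi, rfl⟩, rfl⟩ | ⟨rfl, j, hj, rfl⟩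
    · exact (bundleLeft_interleave huw hwv hℓ).elim
    · exact (bundleLeft_gap (by omega) huw hwv).elim
    · exact (bundleLeft_gap le_rfl huw hwv).elim
  · obtain ⟨⟨i, hi, rfl⟩, rfl⟩ := hA
    rcases kinds h' hr' with ⟨h2, rfl⟩ | ⟨⟨i, hi, rfl⟩, rfl⟩ | ⟨rfl, j, hj, rfl⟩
    · omega
    · omega
    · have := lt_of_mul_lt_mul_right huw (Nat.zero_le _)
      omega
  · rcases kinds h' hr' with ⟨h2, rfl⟩ | hA | ⟨rfl, j, hj, rfl⟩
    · obtain ⟨rfl, j, hj, rfl⟩ := hB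
      exact (bundleLeft_gap (by omega) hwv hvz).elim
    · exact ⟨hB, hA⟩
    · exact absurd huw (by rw [hB.1]; exact lt_irrefl _)

/-- The edges of `gridGraph` below the axis do not interleave. -/
lemma not_interleave_down {u v w z : ℕ} (hℓ : 0 < ℓ) (h' : GridEdge k l ℓ w z)
    (huw : u < w) (hwv : w < v) (hvz : v < z)
    (hr : v = bundleRight k l ℓ u) (hr' : z = bundleRight k l ℓ w) : False := by
  have hw : w < (5 + k + l) * ℓ := by
    obtain ⟨hwz, ⟨t, -, -, ⟨h, -⟩ | ⟨h, -⟩⟩ | ⟨-, rfl⟩ | ⟨-, j, hj, rfl⟩⟩ := h'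
    · exact h
    · omega
    · exact hwz
    · exact hwz.trans_le (Nat.mul_le_mul_right _ (by omega))
  subst hr hr'
  have := bundleRight_interleave hℓ hw huw hwv
  omega

/-- The lower page of the drawing with `k * l` crossings. -/
def lowerPage (k l ℓ u v : ℕ) : Prop := v = bundleRight k l ℓ u

/-- The lower page of the grid-free drawing: one star edge is moved below the axis. -/
def lowerPageMoved (k l ℓ u v : ℕ) : Prop :=
  v = bundleRight k l ℓ u ∨ u = 4 * ℓ ∧ v = (5 + k + l) * ℓ

lemma interleave_lowerPage {u v w z : ℕ} (hℓ : 0 < ℓ) (h : GridEdge k l ℓ u v)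
    (h' : GridEdge k l ℓ w z) (huw : u < w) (hwv : w < v) (hvz : v < z)
    (hp : lowerPage k l ℓ u v ↔ lowerPage k l ℓ w z) :
    StarEdgeB k l ℓ u v ∧ StarEdgeA k l ℓ w z := by
  unfold lowerPage at hp
  by_cases hr : v = bundleRight k l ℓ u
  · exact (not_interleave_down hℓ h' huw hwv hvz hr (hp.1 hr)).elim
  · exact starEdges_of_interleave_up hℓ h h' huw hwv hvz hr (fun h => hr (hp.2 h))

lemma interleave_lowerPageMoved {u v w z : ℕ} (hℓ : 0 < ℓ) (h : GridEdge k l ℓ u v)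
    (h' : GridEdge k l ℓ w z) (huw : u < w) (hwv : w < v) (hvz : v < z)
    (hp : lowerPageMoved k l ℓ u v ↔ lowerPageMoved k l ℓ w z) :
    (StarEdgeB k l ℓ u v ∧ StarEdgeA k l ℓ w z ∧ w ≠ 4 * ℓ) ∨
      (v = bundleRight k l ℓ u ∧ w = 4 * ℓ ∧ z = (5 + k + l) * ℓ) := by
  unfold lowerPageMoved at hp
  have hz : z ≤ (5 + k + l) * ℓ := by
    obtain ⟨hwz, ⟨t, -, -, ⟨h, rfl, -⟩ | ⟨h, -⟩⟩ | ⟨-, rfl⟩ | ⟨-, j, hj, rfl⟩⟩ := h'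
    · exact bundleRight_le hℓ h
    · exact h.le
    · exact le_rfl
    · exact Nat.mul_le_mul_right _ (by omega)
  by_cases hr : v = bundleRight k l ℓ u
  · rcases hp.1 (Or.inl hr) with h1 | h1
    · exact (not_interleave_down hℓ h' huw hwv hvz hr h1).elim
    · exact Or.inr ⟨hr, h1⟩
  · by_cases hm : u = 4 * ℓ ∧ v = (5 + k + l) * ℓ
    · omega
    · have hn : ¬ (z = bundleRight k l ℓ w ∨ w = 4 * ℓ ∧ z = (5 + k + l) * ℓ) :=
        fun h => (hp.2 h).elim hr hm
      obtain ⟨hB, hA⟩ := starEdges_of_interleave_up hℓ h h' huw hwv hvz hr (fun h => hn (Or.inl h))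
      exact Or.inl ⟨hB, hA, fun h => hn (Or.inr ⟨h, hA.2⟩)⟩

lemma specialInterleaving_lowerPage (hℓ : 0 < ℓ) (n : ℕ) :
    SpecialInterleaving (gridGraph k l ℓ n) (lowerPage k l ℓ) (StarEdgeA k l ℓ) := by
  intro u v w z h h' huw hwv hvz hp
  obtain ⟨hB, hA⟩ := interleave_lowerPage hℓ (gridEdge_of_adj h (huw.trans hwv))
    (gridEdge_of_adj h' (hwv.trans hvz)) huw hwv hvz hp
  exact iff_of_false (fun h => not_starEdgeB_of_starEdgeA hℓ h hB) (not_not.2 hA)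

lemma specialInterleaving_lowerPageMoved (hℓ : 0 < ℓ) (hk : 0 < k) (n : ℕ) :
    SpecialInterleaving (gridGraph k l ℓ n) (lowerPageMoved k l ℓ) (StarEdgeA k l ℓ) := by
  intro u v w z h h' huw hwv hvz hp
  rcases interleave_lowerPageMoved hℓ (gridEdge_of_adj h (huw.trans hwv))
    (gridEdge_of_adj h' (hwv.trans hvz)) huw hwv hvz hp with ⟨hB, hA, -⟩ | ⟨hr, hw, hz⟩
  · exact iff_of_false (fun h => not_starEdgeB_of_starEdgeA hℓ h hB) (not_not.2 hA)
  · exact iff_of_false (fun h => not_bundleRight_of_starEdgeA hℓ h hr)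
      (not_not.2 ⟨⟨0, hk, by simpa using hw⟩, hz⟩)

/-- The `i`-th edge of the first star. -/
def starA {n : ℕ} (hn : (5 + k + l) * ℓ < n) (i : Fin k) : Sym2 (Fin n) :=
  s(⟨(4 + i) * ℓ, (Nat.mul_le_mul_right ℓ (by omega)).trans_lt hn⟩, ⟨(5 + k + l) * ℓ, hn⟩)

/-- The `j`-th edge of the second star. -/
def starB {n : ℕ} (hn : (5 + k + l) * ℓ < n) (j : Fin l) : Sym2 (Fin n) :=
  s(⟨3 * ℓ, (Nat.mul_le_mul_right ℓ (by omega)).trans_lt hn⟩,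
    ⟨(5 + k + j) * ℓ, (Nat.mul_le_mul_right ℓ (by omega)).trans_lt hn⟩)

lemma StarEdgeA.exists_eq_starA {n : ℕ} (hn : (5 + k + l) * ℓ < n) {u v : Fin n}
    (h : StarEdgeA k l ℓ u v) : ∃ i, s(u, v) = starA hn i := by
  obtain ⟨⟨i, hi, hu⟩, hv⟩ := h
  refine ⟨⟨i, hi⟩, ?_⟩
  exact Sym2.eq_iff.2 (Or.inl ⟨Fin.ext hu, Fin.ext hv⟩)

lemma StarEdgeB.exists_eq_starB {n : ℕ} (hn : (5 + k + l) * ℓ < n) {u v : Fin n}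
    (h : StarEdgeB k l ℓ u v) : ∃ j, s(u, v) = starB hn j := by
  obtain ⟨hu, j, hj, hv⟩ := h
  refine ⟨⟨j, hj⟩, ?_⟩
  exact Sym2.eq_iff.2 (Or.inl ⟨Fin.ext hu, Fin.ext hv⟩)

lemma crNum_gridGraph_le {n : ℕ} (hk : 0 < k) (hl : 0 < l) (hℓ : 0 < ℓ)
    (hn : (5 + k + l) * ℓ < n) :
    crNum (gridGraph k l ℓ n) ≤ k * l := by
  let Γ := bookDrawing (specialInterleaving_lowerPage (k := k) (l := l) hℓ n)
  refine (Nat.sInf_le ⟨Γ, rfl⟩ : crNum (gridGraph k l ℓ n) ≤ Γ.crossings).trans ?_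
  have h : ∀ p ∈ Γ.crossingSet, ∃ q : Fin k × Fin l,
      Γ.Crossing (starB hn q.2) (starA hn q.1) p := by
    rintro p ⟨e, f, hp⟩
    obtain ⟨u, v, w, z, h, h', huw, hwv, hvz, hd, ho⟩ :=
      exists_interleaving_of_bookDrawing_crossing _ hp
    obtain ⟨hB, hA⟩ := interleave_lowerPage hℓ (gridEdge_of_adj h (huw.trans hwv))
      (gridEdge_of_adj h' (hwv.trans hvz)) huw hwv hvz hd
    obtain ⟨i, hi⟩ := hA.exists_eq_starA hn
    obtain ⟨j, hj⟩ := hB.exists_eq_starB hn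
    rw [hi, hj] at ho
    rcases ho with ⟨rfl, rfl⟩ | ⟨rfl, rfl⟩
    · exact ⟨(i, j), hp⟩
    · exact ⟨(i, j), hp.symm⟩
  have : Nonempty (Fin k × Fin l) := ⟨(⟨0, hk⟩, ⟨0, hl⟩)⟩
  choose! q hq using h
  have hle := Set.ncard_le_ncard_of_injOn (s := Γ.crossingSet) (t := Set.univ) q
    (fun _ _ => Set.mem_univ _) (fun p hp p' hp' hpp =>
      bookDrawing_crossing_unique _ (hq p hp) (by rw [hpp]; exact hq p' hp')) Set.finite_univ
  have hcard : Γ.crossingSet.ncard ≤ k * l := by simpa [Set.ncard_univ] using hle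
  exact hcard

/-- A relation whose pairs all have exactly one member in `E` and whose `E`-member `e₀` has no
neighbour in common with the others contains no `k × l` grid, if `E` and `F` are small. -/
lemma no_grid_of_disjoint_neighbours {α : Type} {C : α → α → Prop} {E F : Finset α} {e₀ : α}
    (hk : 1 < k) (hl : 1 < l) (hE : E.card ≤ k) (hF : F.card ≤ l) (he₀ : e₀ ∈ E)
    (hsymm : ∀ a b, C a b → C b a) (hC : ∀ a b, C a b → (a ∈ E ↔ b ∉ E))
    (h0 : ∀ b, C e₀ b → b ∉ F) (h1 : ∀ a ∈ E, a ≠ e₀ → ∀ b, C a b → b ∈ F) :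
    ¬ ∃ A B : Finset α, A.card = k ∧ B.card = l ∧ ∀ e ∈ A, ∀ f ∈ B, C e f := by
  rintro ⟨A, B, rfl, rfl, h⟩
  obtain ⟨a, ha⟩ := Finset.card_pos.1 (zero_lt_one.trans hk)
  obtain ⟨b, hb⟩ := Finset.card_pos.1 (zero_lt_one.trans hl)
  by_cases haE : a ∈ E
  · have hAE : A ⊆ E := fun x hx => (hC _ _ (h x hx b hb)).2 ((hC _ _ (h a ha b hb)).1 haE)
    have hAE' : A = E := Finset.eq_of_subset_of_card_le hAE hE
    obtain ⟨a', ha', hne⟩ := Finset.exists_mem_ne hk e₀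
    exact h0 b (h _ (hAE' ▸ he₀) b hb) (h1 a' (hAE ha') hne b (h a' ha' b hb))
  · have hBE : B ⊆ E := fun x hx => by
      by_contra hx'
      exact haE ((hC _ _ (h a ha x hx)).2 hx')
    obtain ⟨b', hb', hne⟩ := Finset.exists_mem_ne hl e₀
    have hAF : A ⊆ F := fun x hx => h1 b' (hBE hb') hne x (hsymm _ _ (h x hx b' hb'))
    have c1 := Finset.card_le_card hAF
    have c2 := Finset.card_le_card hBE
    have hBE' : B = E := Finset.eq_of_subset_of_card_le hBE (by omega)
    exact h0 a (hsymm _ _ (h a ha e₀ (hBE' ▸ he₀))) (hAF ha)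

lemma exists_isGridFree_gridGraph {n : ℕ} (hk : 1 < k) (hl : 1 < l) (hℓ : 0 < ℓ)
    (hn : (5 + k + l) * ℓ < n) : ∃ Γ : Drawing (gridGraph k l ℓ n), Γ.IsGridFree k l := by
  classical
  have hX := specialInterleaving_lowerPageMoved (k := k) (l := l) hℓ (by omega) n
  refine ⟨bookDrawing hX, ?_⟩
  have memA : ∀ u v : Fin n, u < v → (s(u, v) ∈ Finset.univ.image (starA hn) ↔
      StarEdgeA k l ℓ u v) := by
    intro u v huv
    constructor
    · intro h
      obtain ⟨i, -, hi⟩ := Finset.mem_image.1 h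
      rcases Sym2.eq_iff.1 hi with ⟨rfl, rfl⟩ | ⟨rfl, rfl⟩
      · exact ⟨⟨i, i.2, rfl⟩, rfl⟩
      · have := lt_of_mul_lt_mul_right (Fin.lt_def.1 huv) (Nat.zero_le _)
        omega
    · intro h
      obtain ⟨i, hi⟩ := h.exists_eq_starA hn
      exact Finset.mem_image.2 ⟨i, Finset.mem_univ _, hi.symm⟩
  have memB : ∀ u v : Fin n, u < v → (s(u, v) ∈ Finset.univ.image (starB hn) ↔
      StarEdgeB k l ℓ u v) := by
    intro u v huv
    constructor
    · intro h
      obtain ⟨i, -, hi⟩ := Finset.mem_image.1 h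
      rcases Sym2.eq_iff.1 hi with ⟨rfl, rfl⟩ | ⟨rfl, rfl⟩
      · exact ⟨rfl, i, i.2, rfl⟩
      · have := lt_of_mul_lt_mul_right (Fin.lt_def.1 huv) (Nat.zero_le _)
        omega
    · intro h
      obtain ⟨i, hi⟩ := h.exists_eq_starB hn
      exact Finset.mem_image.2 ⟨i, Finset.mem_univ _, hi.symm⟩
  let e₀ : Sym2 (Fin n) := starA hn ⟨0, by omega⟩
  have eq0 : ∀ u v : Fin n, u < v → (s(u, v) = e₀ ↔
      (u : ℕ) = 4 * ℓ ∧ (v : ℕ) = (5 + k + l) * ℓ) := by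
    intro u v huv
    constructor
    · intro h
      rcases Sym2.eq_iff.1 h with ⟨rfl, rfl⟩ | ⟨rfl, rfl⟩
      · exact ⟨rfl, rfl⟩
      · have := lt_of_mul_lt_mul_right (Fin.lt_def.1 huv) (Nat.zero_le _)
        simp only at this
        omega
    · rintro ⟨hu, hv⟩
      exact Sym2.eq_iff.2 (Or.inl ⟨Fin.ext (by simpa using hu), Fin.ext hv⟩)
  -- each crossing pairs a star edge `a` with an edge `b` outside the first star
  have main : ∀ e f, (bookDrawing hX).Crosses e f → ∃ a b, (e = a ∧ f = b ∨ e = b ∧ f = a) ∧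
      a ∈ Finset.univ.image (starA hn) ∧ b ∉ Finset.univ.image (starA hn) ∧
      (a = e₀ → b ∉ Finset.univ.image (starB hn)) ∧
      (a ≠ e₀ → b ∈ Finset.univ.image (starB hn)) := by
    rintro e f ⟨p, hp⟩
    obtain ⟨u, v, w, z, h, h', huw, hwv, hvz, hd, ho⟩ :=
      exists_interleaving_of_bookDrawing_crossing _ hp
    have huv := huw.trans hwv
    have hwz := hwv.trans hvz
    refine ⟨s(w, z), s(u, v), by tauto, ?_⟩
    rw [memA _ _ huv, memB _ _ huv, memA _ _ hwz, Ne, eq0 _ _ hwz]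
    rcases interleave_lowerPageMoved hℓ (gridEdge_of_adj h huv) (gridEdge_of_adj h' hwz)
      huw hwv hvz hd with ⟨hB, hA, hne⟩ | ⟨hr, hw, hz⟩
    · exact ⟨hA, fun h => not_starEdgeB_of_starEdgeA hℓ h hB, fun h => (hne h.1).elim, fun _ => hB⟩
    · exact ⟨⟨⟨0, by omega, by simpa using hw⟩, hz⟩, fun h => not_bundleRight_of_starEdgeA hℓ h hr,
        fun _ h => not_bundleRight_of_starEdgeB hℓ h hr, fun h => (h ⟨hw, hz⟩).elim⟩
  refine no_grid_of_disjoint_neighbours (E := Finset.univ.image (starA hn))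
    (F := Finset.univ.image (starB hn)) (e₀ := e₀) hk hl
    (Finset.card_image_le.trans (by simp)) (Finset.card_image_le.trans (by simp))
    (Finset.mem_image_of_mem _ (Finset.mem_univ _)) (fun _ _ h => h.symm) ?_ ?_ ?_
  · intro e f h
    obtain ⟨a, b, ⟨rfl, rfl⟩ | ⟨rfl, rfl⟩, ha, hb, -⟩ := main e f h <;> tauto
  · intro f h
    obtain ⟨a, b, ⟨h1, rfl⟩ | ⟨rfl, rfl⟩, ha, hb, h2, -⟩ := main _ f h
    · exact h2 h1.symm
    · exact (hb (Finset.mem_image_of_mem _ (Finset.mem_univ _))).elim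
  · intro e he hne f h
    obtain ⟨a, b, ⟨rfl, rfl⟩ | ⟨rfl, rfl⟩, ha, hb, -, h2⟩ := main e f h
    · exact h2 hne
    · exact (hb he).elim

lemma le_mul_div_of_lt {v : ℕ} (hℓ : 0 < ℓ) : v < (v / ℓ + 1) * ℓ := by
  rw [add_mul, one_mul]
  exact Nat.lt_div_mul_add hℓ

lemma bundleLeft_le (v : ℕ) : bundleLeft ℓ v ≤ v := by
  unfold bundleLeft
  split_ifs
  · exact Nat.zero_le _
  · exact Nat.div_mul_le_self v ℓ

lemma lt_bundleRight {v : ℕ} (hℓ : 0 < ℓ) : v < bundleRight k l ℓ v := by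
  unfold bundleRight
  split_ifs with h1 h2
  · exact h1.trans_le (Nat.le_mul_of_pos_left _ (by omega))
  · exact h2.trans_le (Nat.mul_le_mul_right _ (by omega))
  · exact le_mul_div_of_lt hℓ

/-- The edges of `gridGraph` on the `t`-th path of some bundle. -/
def copyEdges (k l ℓ n t : ℕ) : Set (Sym2 (Fin n)) :=
  {e | ∃ u v : Fin n, e = s(u, v) ∧ CopyEdge k l ℓ t u v}

lemma copyEdges_subset_edgeSet {n t : ℕ} (ht : t < ℓ) :
    copyEdges k l ℓ n t ⊆ (gridGraph k l ℓ n).edgeSet := by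
  rintro _ ⟨u, v, rfl, h⟩
  exact Or.inl ⟨h.1, Or.inl ⟨t, ht, h⟩⟩

lemma CopyEdge.eq_of_copyEdge {u v t t' : ℕ} (hℓ : 0 < ℓ) (h : CopyEdge k l ℓ t u v)
    (h' : CopyEdge k l ℓ t' u v) : t = t' := by
  obtain ⟨-, ⟨h1, h2, h3⟩ | ⟨h1, h2, h3⟩⟩ := h <;>
  obtain ⟨-, ⟨h1', h2', h3'⟩ | ⟨h1', h2', h3'⟩⟩ := h'
  · exact h3.symm.trans h3'
  · exact (bundleRight_ne_of_eq_bundleLeft hℓ h1' h2' h2).elim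
  · exact (bundleRight_ne_of_eq_bundleLeft hℓ h1 h2 h2').elim
  · exact h3.symm.trans h3'

lemma eq_of_mem_copyEdges {n t t' : ℕ} {e : Sym2 (Fin n)} (hℓ : 0 < ℓ)
    (h : e ∈ copyEdges k l ℓ n t) (h' : e ∈ copyEdges k l ℓ n t') : t = t' := by
  obtain ⟨u, v, rfl, h⟩ := h
  obtain ⟨u', v', he, h'⟩ := h'
  rcases Sym2.eq_iff.1 he with ⟨rfl, rfl⟩ | ⟨rfl, rfl⟩
  · exact h.eq_of_copyEdge hℓ h'
  · exact (lt_asymm h.1 h'.1).elim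

lemma starA_mem_edgeSet {n : ℕ} (hℓ : 0 < ℓ) (hn : (5 + k + l) * ℓ < n) (i : Fin k) :
    starA hn i ∈ (gridGraph k l ℓ n).edgeSet :=
  Or.inl ⟨Nat.mul_lt_mul_of_pos_right (by omega) hℓ, Or.inr (Or.inl ⟨⟨i, i.2, rfl⟩, rfl⟩)⟩

lemma starB_mem_edgeSet {n : ℕ} (hℓ : 0 < ℓ) (hn : (5 + k + l) * ℓ < n) (j : Fin l) :
    starB hn j ∈ (gridGraph k l ℓ n).edgeSet :=
  Or.inl ⟨Nat.mul_lt_mul_of_pos_right (by omega) hℓ, Or.inr (Or.inr ⟨rfl, j, j.2, rfl⟩)⟩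

lemma starA_notMem_copyEdges {n t : ℕ} (hℓ : 0 < ℓ) (hn : (5 + k + l) * ℓ < n) (i : Fin k) :
    starA hn i ∉ copyEdges k l ℓ n t := by
  rintro ⟨u, v, he, huv, h⟩
  have hlt : (4 + (i : ℕ)) * ℓ < (5 + k + l) * ℓ := Nat.mul_lt_mul_of_pos_right (by omega) hℓ
  rcases Sym2.eq_iff.1 he with ⟨rfl, rfl⟩ | ⟨rfl, rfl⟩
  · rcases h with ⟨-, h, -⟩ | ⟨h, -⟩
    · exact not_bundleRight_of_starEdgeA hℓ ⟨⟨i, i.2, rfl⟩, rfl⟩ h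
    · exact lt_irrefl _ h
  · exact lt_asymm hlt huv

lemma starB_notMem_copyEdges {n t : ℕ} (hℓ : 0 < ℓ) (hn : (5 + k + l) * ℓ < n) (j : Fin l) :
    starB hn j ∉ copyEdges k l ℓ n t := by
  rintro ⟨u, v, he, huv, h⟩
  have hlt : 3 * ℓ < (5 + k + (j : ℕ)) * ℓ := Nat.mul_lt_mul_of_pos_right (by omega) hℓ
  rcases Sym2.eq_iff.1 he with ⟨rfl, rfl⟩ | ⟨rfl, rfl⟩
  · rcases h with ⟨-, h, -⟩ | ⟨-, h, -⟩
    · exact not_bundleRight_of_starEdgeB hℓ ⟨rfl, j, j.2, rfl⟩ h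
    · dsimp only at h
      rw [bundleLeft, if_neg (by omega), Nat.mul_div_cancel _ hℓ] at h
      omega
  · exact lt_asymm hlt huv

lemma starA_injective {n : ℕ} (hℓ : 0 < ℓ) (hn : (5 + k + l) * ℓ < n) :
    Function.Injective (starA (k := k) (l := l) hn) := by
  intro i i' h
  rcases Sym2.eq_iff.1 h with ⟨h1, -⟩ | ⟨h1, -⟩
  · have := Nat.eq_of_mul_eq_mul_right hℓ (Fin.mk.inj h1)
    omega
  · have := Nat.eq_of_mul_eq_mul_right hℓ (Fin.mk.inj h1)
    omega

lemma starB_injective {n : ℕ} (hℓ : 0 < ℓ) (hn : (5 + k + l) * ℓ < n) :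
    Function.Injective (starB (k := k) (l := l) hn) := by
  intro j j' h
  rcases Sym2.eq_iff.1 h with ⟨-, h1⟩ | ⟨h1, -⟩
  · have := Nat.eq_of_mul_eq_mul_right hℓ (Fin.mk.inj h1)
    omega
  · have := Nat.eq_of_mul_eq_mul_right hℓ (Fin.mk.inj h1)
    omega

/-- The ends of a bundle are joined along the `t`-th path of the bundle. -/
lemma joinedIn_bundle {n t : ℕ} (hℓ : 0 < ℓ) (Γ : Drawing (gridGraph k l ℓ n))
    {S : Set (Sym2 (Fin n))} (hS : S ⊆ (gridGraph k l ℓ n).edgeSet)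
    (hCS : copyEdges k l ℓ n t ⊆ S) {U : Set (Fin n)} {p q r : Fin n}
    (hp : (p : ℕ) < (5 + k + l) * ℓ) (hpt : (p : ℕ) % ℓ = t)
    (hq : (q : ℕ) = bundleLeft ℓ p) (hr : (r : ℕ) = bundleRight k l ℓ p)
    (hqU : q ∈ U) (hpU : p ∈ U) (hrU : r ∈ U) :
    JoinedIn (Γ.region {e ∈ S | ∀ v ∈ e, v ∈ U}) (Γ.vpos q) (Γ.vpos r) := by
  have edge : ∀ u v : Fin n, u ∈ U → v ∈ U → CopyEdge k l ℓ t u v →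
      JoinedIn (Γ.region {e ∈ S | ∀ v ∈ e, v ∈ U}) (Γ.vpos u) (Γ.vpos v) := by
    intro u v hu hv h
    have hmem : s(u, v) ∈ S := hCS ⟨u, v, rfl, h⟩
    refine Γ.joinedIn_region (hS hmem) ⟨hmem, fun w hw => ?_⟩
    rcases Sym2.mem_iff.1 hw with rfl | rfl <;> assumption
  have hpr : JoinedIn (Γ.region {e ∈ S | ∀ v ∈ e, v ∈ U}) (Γ.vpos p) (Γ.vpos r) :=
    edge p r hpU hrU ⟨hr ▸ lt_bundleRight hℓ, Or.inl ⟨hp, hr, hpt⟩⟩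
  rcases (hq ▸ bundleLeft_le (p : ℕ) : (q : ℕ) ≤ p).eq_or_lt with h | h
  · rwa [Fin.ext h]
  · exact (edge q p hqU hpU ⟨h, Or.inr ⟨hp, hq, hpt⟩⟩).trans hpr

/-- Two vertices of the cycle of bundles are joined along the `t`-th paths of the bundles
between them. -/
lemma joinedIn_cycle {n t : ℕ} (ht : t < ℓ) (Γ : Drawing (gridGraph k l ℓ n))
    {S : Set (Sym2 (Fin n))} (hS : S ⊆ (gridGraph k l ℓ n).edgeSet)
    (hCS : copyEdges k l ℓ n t ⊆ S) {q : Fin n} {α : ℕ} (hα : 3 ≤ α) (hq : (q : ℕ) = α * ℓ)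
    {β : ℕ} (hαβ : α < β) (hβ : β ≤ 5 + k + l) {r : Fin n} (hr : (r : ℕ) = β * ℓ) :
    JoinedIn (Γ.region {e ∈ S | ∀ v ∈ e, v ∈ Set.Icc q r}) (Γ.vpos q) (Γ.vpos r) := by
  have hℓ : 0 < ℓ := by omega
  have step : ∀ γ, α ≤ γ → γ < β → ∀ u v : Fin n, (u : ℕ) = γ * ℓ → (v : ℕ) = (γ + 1) * ℓ →
      JoinedIn (Γ.region {e ∈ S | ∀ v ∈ e, v ∈ Set.Icc q r}) (Γ.vpos u) (Γ.vpos v) := by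
    intro γ h1 h2 u v hu hv
    have h3 : α * ℓ ≤ γ * ℓ := Nat.mul_le_mul_right _ h1
    have h4 : (γ + 1) * ℓ ≤ β * ℓ := Nat.mul_le_mul_right _ h2
    have h5 : β * ℓ ≤ (5 + k + l) * ℓ := Nat.mul_le_mul_right _ hβ
    have h6 : 3 * ℓ ≤ γ * ℓ := Nat.mul_le_mul_right _ (hα.trans h1)
    have h7 : (γ + 1) * ℓ = γ * ℓ + ℓ := by ring
    have h8 : (γ * ℓ + t) / ℓ = γ := by
      rw [mul_comm, Nat.mul_add_div hℓ, Nat.div_eq_of_lt ht, add_zero]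
    refine joinedIn_bundle (p := ⟨γ * ℓ + t, by omega⟩) hℓ Γ hS hCS (by simp only; omega) ?_ ?_ ?_
      ?_ ?_ ?_
    · simp [Nat.mod_eq_of_lt ht]
    · rw [hu, bundleLeft, if_neg (by simp only; omega), h8]
    · rw [hv, bundleRight, if_neg (by simp only; omega), if_neg (by simp only; omega), h8]
    all_goals
      simp only [Set.mem_Icc, Fin.le_def]
      omega
  have main : ∀ γ, α < γ → γ ≤ β → ∀ v : Fin n, (v : ℕ) = γ * ℓ →
      JoinedIn (Γ.region {e ∈ S | ∀ v ∈ e, v ∈ Set.Icc q r}) (Γ.vpos q) (Γ.vpos v) := by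
    intro γ hγ
    induction γ, hγ using Nat.le_induction with
    | base => exact fun h v hv => step α le_rfl h q v hq hv
    | succ γ hγ ih =>
      intro h v hv
      have h5 : (γ + 1) * ℓ ≤ (5 + k + l) * ℓ := Nat.mul_le_mul_right _ (h.trans hβ)
      have h7 : (γ + 1) * ℓ = γ * ℓ + ℓ := by ring
      exact (ih (by omega) ⟨γ * ℓ, by omega⟩ rfl).trans
        (step γ (by omega) h ⟨γ * ℓ, by omega⟩ v rfl hv)
  exact main β hαβ le_rfl r hr

/-- Sets containing the positions of the nine pairwise independent paths that form a subdivision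
of the complete bipartite graph with parts `a, 3 * ℓ, x` and `c, d, 0`. -/
def pathRange (ℓ a c d x : ℕ) : Fin 3 → Fin 3 → Set ℕ :=
  ![![{a, c}, Set.Icc d a, {v | v < ℓ ∨ v = a}],
    ![Set.Icc (3 * ℓ) c, {3 * ℓ, d}, {v | v = 0 ∨ 2 * ℓ ≤ v ∧ v ≤ 3 * ℓ}],
    ![Set.Icc c x, Set.Icc x d, {v | v = 0 ∨ ℓ ≤ v ∧ v < 2 * ℓ ∨ v = x}]]

lemma disjoint_pathRange {a c d x : ℕ} (hℓ : 0 < ℓ) (hc : 3 * ℓ + ℓ ≤ c) (hx : c + ℓ ≤ x)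
    (hd : x + ℓ ≤ d) (ha : d + ℓ ≤ a) {i i' j j' : Fin 3} (hi : i ≠ i') (hj : j ≠ j') :
    Disjoint (pathRange ℓ a c d x i j) (pathRange ℓ a c d x i' j') := by
  wlog hlt : i < i' generalizing i i' j j'
  · exact (this hi.symm hj.symm (lt_of_le_of_ne (not_lt.1 hlt) hi.symm)).symm
  rw [Set.disjoint_left]
  intro v hv hv'
  fin_cases i <;> fin_cases i' <;> first | exact absurd hlt (by decide) | skip
  all_goals
    fin_cases j <;> fin_cases j' <;> first | exact hj rfl | skip
    all_goals
      simp [pathRange] at hv hv'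
      omega

/-- In a drawing in which two given edges of the two stars do not cross, every family of `t`-th
paths of the bundles contains a crossed edge. -/
lemma exists_crossing_copyEdges {n t : ℕ} (ht : t < ℓ) (hn : (5 + k + l) * ℓ < n)
    (Γ : Drawing (gridGraph k l ℓ n)) (i : Fin k) (j : Fin l) :
    ∃ e ∈ copyEdges k l ℓ n t ∪ {starA hn i, starB hn j},
      ∃ f ∈ copyEdges k l ℓ n t ∪ {starA hn i, starB hn j}, ∃ p, Γ.Crossing e f p := by
  have hℓ : 0 < ℓ := by omega
  have hi := i.2
  have hj := j.2
  obtain ⟨c, hc⟩ : ∃ c, c = (4 + (i : ℕ)) * ℓ := ⟨_, rfl⟩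
  obtain ⟨x, hx⟩ : ∃ x, x = (4 + k) * ℓ := ⟨_, rfl⟩
  obtain ⟨d, hd⟩ : ∃ d, d = (5 + k + (j : ℕ)) * ℓ := ⟨_, rfl⟩
  obtain ⟨a, ha⟩ : ∃ a, a = (5 + k + l) * ℓ := ⟨_, rfl⟩
  have hbc : 3 * ℓ + ℓ ≤ c := by
    rw [hc, ← Nat.succ_mul]; exact Nat.mul_le_mul_right _ (by omega)
  have hcx : c + ℓ ≤ x := by
    rw [hc, hx, ← Nat.succ_mul]; exact Nat.mul_le_mul_right _ (by omega)
  have hxd : x + ℓ ≤ d := by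
    rw [hd, hx, ← Nat.succ_mul]; exact Nat.mul_le_mul_right _ (by omega)
  have hda : d + ℓ ≤ a := by
    rw [hd, ha, ← Nat.succ_mul]; exact Nat.mul_le_mul_right _ (by omega)
  have han : a < n := ha ▸ hn
  let vy : Fin n := ⟨0, by omega⟩
  let vb : Fin n := ⟨3 * ℓ, by omega⟩
  let vc : Fin n := ⟨c, by omega⟩
  let vx : Fin n := ⟨x, by omega⟩
  let vd : Fin n := ⟨d, by omega⟩
  let va : Fin n := ⟨a, by omega⟩
  have hA : starA hn i = s(vc, va) := Sym2.eq_iff.2 (Or.inl ⟨Fin.ext hc.symm, Fin.ext ha.symm⟩)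
  have hB : starB hn j = s(vb, vd) := Sym2.eq_iff.2 (Or.inl ⟨rfl, Fin.ext hd.symm⟩)
  set S : Set (Sym2 (Fin n)) := copyEdges k l ℓ n t ∪ {starA hn i, starB hn j}
  have hCS : copyEdges k l ℓ n t ⊆ S := Set.subset_union_left
  have hAS : starA hn i ∈ S := Or.inr (Or.inl rfl)
  have hBS : starB hn j ∈ S := Or.inr (Or.inr rfl)
  have hS : S ⊆ (gridGraph k l ℓ n).edgeSet := by
    rintro e (he | rfl | rfl)
    · exact copyEdges_subset_edgeSet ht he
    · exact starA_mem_edgeSet hℓ hn i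
    · exact starB_mem_edgeSet hℓ hn j
  have edge : ∀ (u v : Fin n) (W : Set (Fin n)), s(u, v) ∈ S → u ∈ W → v ∈ W →
      JoinedIn (Γ.region {e ∈ S | ∀ w ∈ e, w ∈ W}) (Γ.vpos u) (Γ.vpos v) := by
    refine fun u v W h hu hv => Γ.joinedIn_region (hS h) ⟨h, fun w hw => ?_⟩
    rcases Sym2.mem_iff.1 hw with rfl | rfl <;> assumption
  have hxpos : (vx : ℕ) = (4 + k) * ℓ := hx
  let U : Fin 3 → Fin 3 → Set (Fin n) := fun i j => Fin.val ⁻¹' pathRange ℓ a c d x i j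
  refine Γ.exists_crossing_of_subdivision hS ![va, vb, vx] ![vc, vd, vy] U ?_ ?_
  · exact fun i i' j j' hi hj =>
      (disjoint_pathRange hℓ hbc hcx hxd hda hi hj).preimage _
  · intro i j
    fin_cases i <;> fin_cases j
    · exact (edge vc va _ (hA ▸ hAS) (by simp [U, pathRange, vc]) (by simp [U, pathRange, va])).symm
    · exact (joinedIn_cycle ht Γ hS hCS (by omega) hd (by omega) le_rfl ha).symm
    · refine (joinedIn_bundle (p := ⟨t, by omega⟩) hℓ Γ hS hCS (by simp only; omega)
        (Nat.mod_eq_of_lt ht) (q := vy) (r := va) ?_ ?_ ?_ ?_ ?_).symm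
      · simp [vy, bundleLeft]; omega
      · simp [va, bundleRight, ht, ha]
      · simp [U, pathRange, vy, hℓ]
      · simp [U, pathRange, ht]
      · simp [U, pathRange, va]
    · exact joinedIn_cycle ht Γ hS hCS le_rfl rfl (by omega) (by omega) hc
    · exact edge vb vd _ (hB ▸ hBS) (by simp [U, pathRange, vb]) (by simp [U, pathRange, vd])
    · refine (joinedIn_bundle (p := ⟨2 * ℓ + t, by omega⟩) hℓ Γ hS hCS (by simp only; omega)
        (by simp [Nat.mod_eq_of_lt ht]) (q := vy) (r := vb) ?_ ?_ ?_ ?_ ?_).symm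
      · simp [vy, bundleLeft]; omega
      · have h2 : (2 * ℓ + t) / ℓ = 2 := by
          rw [mul_comm, Nat.mul_add_div hℓ, Nat.div_eq_of_lt ht]
        simp only [vb, bundleRight, h2]
        rw [if_neg (by omega), if_neg (by omega)]
      · simp [U, pathRange, vy]
      · simp [U, pathRange]; omega
      · simp [U, pathRange, vb]; omega
    · exact (joinedIn_cycle ht Γ hS hCS (by omega) hc (by omega) (by omega) hxpos).symm
    · exact joinedIn_cycle ht Γ hS hCS (by omega) hxpos (by omega) (by omega) hd
    · refine (joinedIn_bundle (p := ⟨ℓ + t, by omega⟩) hℓ Γ hS hCS (by simp only; omega)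
        (by simp [Nat.mod_eq_of_lt ht]) (q := vy) (r := vx) ?_ ?_ ?_ ?_ ?_).symm
      · simp [vy, bundleLeft]; omega
      · simp only [vx, bundleRight]
        rw [if_neg (by omega), if_pos (by omega), hx]
      · simp [U, pathRange, vy]
      · simp [U, pathRange]; omega
      · simp [U, pathRange, vx]

lemma le_crossings_of_isGridFree {n : ℕ} (hn : (5 + k + l) * ℓ < n)
    (Γ : Drawing (gridGraph k l ℓ n)) (hΓ : Γ.IsGridFree k l) : ℓ ≤ Γ.crossings := by
  classical
  rcases Nat.eq_zero_or_pos ℓ with h0 | hℓ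
  · exact h0.le.trans (Nat.zero_le _)
  obtain ⟨i, j, hij⟩ : ∃ i j, ¬ Γ.Crosses (starA hn i) (starB hn j) := by
    by_contra! h
    refine hΓ ⟨Finset.univ.image (starA hn), Finset.univ.image (starB hn), ?_, ?_, ?_⟩
    · rw [Finset.card_image_of_injective _ (starA_injective hℓ hn), Finset.card_fin]
    · rw [Finset.card_image_of_injective _ (starB_injective hℓ hn), Finset.card_fin]
    · simpa using h
  refine Γ.le_crossings_of_disjoint (fun t : Fin ℓ => copyEdges k l ℓ n t)
    {starA hn i, starB hn j} (fun t t' e h h' => Fin.ext (eq_of_mem_copyEdges hℓ h h')) ?_ ?_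
  · rintro t e he (rfl | rfl)
    · exact starA_notMem_copyEdges hℓ hn i he
    · exact starB_notMem_copyEdges hℓ hn j he
  · intro t
    obtain ⟨e, he, f, hf, p, h⟩ := exists_crossing_copyEdges t.2 hn Γ i j
    rcases he with he | he
    · exact ⟨e, he, f, hf, p, h⟩
    rcases hf with hf | hf
    · exact ⟨f, hf, e, Or.inr he, p, h.symm⟩
    · rcases he with rfl | rfl <;> rcases hf with rfl | rfl
      · exact (h.2.2.1 rfl).elim
      · exact (hij ⟨p, h⟩).elim
      · exact (hij ⟨p, h.symm⟩).elim
      · exact (h.2.2.1 rfl).elim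

end GridGraph

/-- For all `ℓ ≥ 2`, `k > 1`, `l > 1` there exists a
`(k,l)`-grid-free simple graph on exactly `n = 4(k+l)ℓ - 2(k+l) + 1` vertices
with `cr_{(k,l)-grid-free}(G) ≥ ℓ` and `cr(G) ≤ kl` (hence the
`(k,l)`-grid-free crossing ratio is `Ω(n/(kl(k+l)))`). -/
theorem gridfree_crossing_ratio_lower (ℓ k l : ℕ) (hℓ : 2 ≤ ℓ) (hk : 1 < k) (hl : 1 < l) :
    ∃ G : SimpleGraph (Fin (4 * (k + l) * ℓ - 2 * (k + l) + 1)),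
      (∃ Γ : Drawing G, Γ.IsGridFree k l) ∧
      ℓ ≤ crNumRestricted G (fun Γ => Γ.IsGridFree k l) ∧
      crNum G ≤ k * l := by
  have hn : (5 + k + l) * ℓ < 4 * (k + l) * ℓ - 2 * (k + l) + 1 := by
    obtain ⟨m, rfl⟩ := Nat.exists_eq_add_of_le hℓ
    obtain ⟨s, hs⟩ := Nat.exists_eq_add_of_le (show 4 ≤ k + l by omega)
    have e1 : (5 + k + l) * (2 + m) = 18 + 9 * m + 2 * s + s * m := by
      rw [add_assoc, hs]; ring
    have e2 : 4 * (k + l) * (2 + m) = 32 + 16 * m + 8 * s + 4 * (s * m) := by rw [hs]; ring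
    rw [e1, e2]
    omega
  refine ⟨gridGraph k l ℓ _, exists_isGridFree_gridGraph hk hl (by omega) hn, ?_,
    crNum_gridGraph_le (by omega) (by omega) (by omega) hn⟩
  obtain ⟨Γ₀, h₀⟩ := exists_isGridFree_gridGraph hk hl (by omega) hn
  exact le_csInf ⟨_, Γ₀, h₀, rfl⟩ fun _ ⟨Γ, hΓ, h⟩ => h ▸ le_crossings_of_isGridFree hn Γ hΓ
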